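/- (Precise large deviations for K_n.) For every fixed x ∈ (0,1) there exists a constant C > 0 such that for all integers n ≥ 1, writing {nx} = ⌈nx⌉ − nx, the upper-tail probability P(K_n ≥ xn) := Σ_{k=⌈xn⌉}^{n} p_{n,k} satisfies | P(K_n ≥ xn) / T_n(x) − 1 | ≤ C/(xn), where T_n(x) = (Γ(θ)/Γ(θ/α)) · n^{(1/α−1)θ−1/2} / ( z(x)·√(2π·|h_x″(z(x))|) ) · x^{θ/α−1} · ( e^{−{nx}·I′(x)} / (1 − e^{−I′(x)}) ) · e^{−n·I(x)}. -/

import Mathlib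

/-- Rising factorial `(a)_{n↑} = Γ(a+n)/Γ(a)`. -/
noncomputable def rfac (a : ℝ) (n : ℕ) : ℝ := Real.Gamma (a + n) / Real.Gamma a

/-- The Ewens–Pitman probability `p_{n,k}` that the number of blocks `K_n` equals `k`. -/
noncomputable def ewensP (α θ : ℝ) (n k : ℕ) : ℝ :=
  ∑' m : Fin n → ℕ,
    if (∑ j, m j = k ∧ ∑ j, (j.1 + 1) * m j = n) then
      (n.factorial : ℝ) * ((∏ i ∈ Finset.range k, (θ + i * α)) / rfac θ n) *
        ∏ j, ((rfac (1 - α) j.1 / Nat.factorial (j.1 + 1)) ^ (m j) /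
          Nat.factorial (m j))
    else 0

/-- The function `h_x(z) = ln z - x ln(1-(1-z)^α)` for `z ∈ (0,1)`. -/
noncomputable def hfun (α x : ℝ) : ℝ → ℝ :=
  fun z => Real.log z - x * Real.log (1 - (1 - z) ^ α)

/-- The rate function `I(x) = h_x(z(x))`, where `zf` is the saddle-point map. -/
noncomputable def Ifun (α : ℝ) (zf : ℝ → ℝ) : ℝ → ℝ :=
  fun x => hfun α x (zf x)

/-- The coefficients of `1 - (1 - z)^α`. -/
noncomputable def sibuya (α : ℝ) : ℕ → ℝ
  | 0 => 0
  | j + 1 => α * (rfac (1 - α) j / Nat.factorial (j + 1))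

lemma rfac_eq_prod {a : ℝ} (ha : 0 < a) (n : ℕ) : rfac a n = ∏ i ∈ Finset.range n, (a + i) := by
  induction n with
  | zero => simp [rfac, (Real.Gamma_pos_of_pos ha).ne']
  | succ n ih =>
    rw [Finset.prod_range_succ, ← ih, rfac, rfac, Nat.cast_succ, ← add_assoc,
      Real.Gamma_add_one (by positivity)]
    ring

lemma sibuya_nonneg {α : ℝ} (hα : α ∈ Set.Ioo (0 : ℝ) 1) (j : ℕ) : 0 ≤ sibuya α j := by
  cases j with
  | zero => exact le_rfl
  | succ j =>
    have := hα.1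
    have h1 : 0 < 1 - α := by linarith [hα.2]
    rw [sibuya, rfac_eq_prod h1]
    positivity

lemma coeff_mk_pow_eq_sum (q : ℕ → ℝ) (hq : q 0 = 0) (n k : ℕ) :
    PowerSeries.coeff n ((PowerSeries.mk q) ^ k) =
      ∑ m ∈ Finset.piAntidiag (Finset.univ : Finset (Fin n)) k,
        if ∑ j, (j.1 + 1) * m j = n then
          (Nat.multinomial Finset.univ m : ℝ) * ∏ j, q (j.1 + 1) ^ m j else 0 := by
  have h1 : PowerSeries.coeff n ((PowerSeries.mk q) ^ k) =
      (((PowerSeries.trunc (n + 1) (PowerSeries.mk q)) ^ k : Polynomial ℝ)).coeff n := by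
    have := PowerSeries.trunc_trunc_pow (PowerSeries.mk q) (n + 1) k
    have h2 := congrArg (fun p => Polynomial.coeff p n) this
    simp only [PowerSeries.coeff_trunc, Nat.lt_succ_self, if_true] at h2
    rw [← h2, ← Polynomial.coe_pow, Polynomial.coeff_coe]
  have h3 : PowerSeries.trunc (n + 1) (PowerSeries.mk q) =
      ∑ j : Fin n, Polynomial.C (q (j.1 + 1)) * Polynomial.X ^ (j.1 + 1) := by
    rw [PowerSeries.trunc_apply, Nat.Ico_zero_eq_range, Finset.sum_range_succ']
    simp only [PowerSeries.coeff_mk, hq, map_zero, add_zero]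
    rw [← Fin.sum_univ_eq_sum_range
      (fun i => (Polynomial.monomial (i + 1)) (q (i + 1)))]
    simp [Polynomial.C_mul_X_pow_eq_monomial]
  rw [h1, h3, Finset.sum_pow_eq_sum_piAntidiag, Polynomial.finsetSum_coeff]
  refine Finset.sum_congr rfl fun m _ => ?_
  have h4 : ∏ j : Fin n, (Polynomial.C (q (j.1 + 1)) * Polynomial.X ^ (j.1 + 1)) ^ m j =
      Polynomial.C (∏ j : Fin n, q (j.1 + 1) ^ m j) *
        Polynomial.X ^ (∑ j : Fin n, (j.1 + 1) * m j) := by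
    simp only [mul_pow, Finset.prod_mul_distrib, ← pow_mul, Finset.prod_pow_eq_pow_sum, map_prod,
      map_pow]
  rw [h4, ← Polynomial.C_eq_natCast, ← mul_assoc, ← map_mul, Polynomial.coeff_C_mul_X_pow]
  simp only [eq_comm]

lemma prod_arith_eq_Gamma {α θ : ℝ} (hα : 0 < α) (hθ : 0 < θ) (k : ℕ) :
    ∏ i ∈ Finset.range k, (θ + i * α) =
      α ^ k * (Real.Gamma (θ / α + k) / Real.Gamma (θ / α)) := by
  have h := rfac_eq_prod (div_pos hθ hα) k
  rw [rfac] at h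
  rw [h, Finset.pow_eq_prod_const, ← Finset.prod_mul_distrib]
  refine Finset.prod_congr rfl fun i _ => ?_
  field_simp

lemma ewensP_eq {α θ : ℝ} (hα : α ∈ Set.Ioo (0 : ℝ) 1) (hθ : 0 < θ) (n k : ℕ) :
    ewensP α θ n k = (n.factorial : ℝ) * (Real.Gamma θ / Real.Gamma (θ + n)) *
      (Real.Gamma (θ / α + k) / (Real.Gamma (θ / α) * k.factorial)) *
      PowerSeries.coeff n ((PowerSeries.mk (sibuya α)) ^ k) := by
  have hα0 := hα.1
  rw [coeff_mk_pow_eq_sum _ rfl, ewensP,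
    tsum_eq_sum (s := Finset.piAntidiag (Finset.univ : Finset (Fin n)) k), Finset.mul_sum]
  · refine Finset.sum_congr rfl fun m hm => ?_
    have hk : ∑ j, m j = k := (Finset.mem_piAntidiag.1 hm).1
    simp only [hk, true_and]
    split_ifs with h
    · have hmul := Nat.multinomial_spec (Finset.univ : Finset (Fin n)) m
      rw [hk] at hmul
      have hmul' : (∏ i, ((m i).factorial : ℝ)) * (Nat.multinomial Finset.univ m : ℝ)
          = k.factorial := by exact_mod_cast hmul
      have hp : (∏ i, ((m i).factorial : ℝ)) ≠ 0 :=
        Finset.prod_ne_zero_iff.2 fun i _ => by positivity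
      have hmn : (Nat.multinomial Finset.univ m : ℝ) = k.factorial / ∏ i, ((m i).factorial : ℝ) := by
        rw [eq_div_iff hp, mul_comm, hmul']
      have hs : ∏ j : Fin n, sibuya α (j.1 + 1) ^ m j =
          α ^ k * ∏ j : Fin n, (rfac (1 - α) j.1 / Nat.factorial (j.1 + 1)) ^ (m j) := by
        simp only [sibuya, mul_pow, Finset.prod_mul_distrib, Finset.prod_pow_eq_pow_sum, hk]
      rw [prod_arith_eq_Gamma hα0 hθ, hmn, hs, Finset.prod_div_distrib, rfac]
      have hk' : (k.factorial : ℝ) ≠ 0 := by positivity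
      have h1 := (Real.Gamma_pos_of_pos hθ).ne'
      have h2 := (Real.Gamma_pos_of_pos (div_pos hθ hα0)).ne'
      have h3 := (Real.Gamma_pos_of_pos (show 0 < θ + n by positivity)).ne'
      field_simp
    · simp
  · intro m hm
    rw [if_neg]
    rintro ⟨h1, -⟩
    exact hm (Finset.mem_piAntidiag.2 ⟨h1, fun _ _ => Finset.mem_univ _⟩)

lemma choose_mul_neg_one_pow {α : ℝ} (hα : α ∈ Set.Ioo (0 : ℝ) 1) (j : ℕ) :
    Ring.choose α (j + 1) * (-1) ^ (j + 1) = - sibuya α (j + 1) := by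
  have h := Ring.descPochhammer_eq_factorial_smul_choose α (j + 1)
  rw [← Polynomial.aeval_eq_smeval, Polynomial.aeval_def, Polynomial.eval₂_eq_eval_map,
    descPochhammer_map, descPochhammer_eval_eq_prod_range, Finset.prod_range_succ', nsmul_eq_mul] at h
  have h1 : 0 < 1 - α := by linarith [hα.2]
  have hf : ((j + 1).factorial : ℝ) ≠ 0 := by positivity
  have hp : ∏ i ∈ Finset.range j, (α - ((i + 1 : ℕ) : ℝ)) =
      (-1) ^ j * ∏ i ∈ Finset.range j, (1 - α + i) := by
    rw [Finset.pow_eq_prod_const, ← Finset.prod_mul_distrib]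
    refine Finset.prod_congr rfl fun i _ => ?_
    push_cast; ring
  have h2 : ((-1 : ℝ) ^ j) * (-1) ^ j = 1 := by rw [← mul_pow]; norm_num
  rw [hp] at h
  rw [sibuya, rfac_eq_prod h1]
  have : Ring.choose α (j + 1) =
      ((-1) ^ j * ∏ i ∈ Finset.range j, (1 - α + i)) * α / (j + 1).factorial := by
    rw [eq_div_iff hf, mul_comm, ← h]; simp
  rw [this, pow_succ]
  calc _ = -(((-1 : ℝ) ^ j) * (-1) ^ j) * (∏ i ∈ Finset.range j, (1 - α + i)) * α
        / (j + 1).factorial := by ring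
    _ = _ := by rw [h2]; ring

lemma hasSum_sibuya {α : ℝ} (hα : α ∈ Set.Ioo (0 : ℝ) 1) {z : ℂ} (hz : ‖z‖ < 1) :
    HasSum (fun j => (sibuya α j : ℂ) * z ^ j) (1 - (1 - z) ^ (α : ℂ)) := by
  have h := (Complex.one_add_cpow_hasFPowerSeriesOnBall_zero (a := (α : ℂ))).hasSum
    (y := -z) (by
      rw [Metric.mem_eball, edist_zero_right, ← ofReal_norm, norm_neg]
      exact ENNReal.ofReal_lt_one.2 hz)
  simp only [binomialSeries_apply, List.ofFn_const, List.prod_replicate, smul_eq_mul,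
    zero_add] at h
  rw [← sub_eq_add_neg] at h
  have h2 := (hasSum_ite_eq (0 : ℕ) (1 : ℂ)).sub h
  have e : (fun j => (sibuya α j : ℂ) * z ^ j) =
      fun j => (if j = 0 then 1 else 0) - Ring.choose (α : ℂ) j * (-z) ^ j := by
    funext j
    cases j with
    | zero => simp [sibuya]
    | succ j =>
      have := congrArg (fun t : ℝ => (t : ℂ)) (choose_mul_neg_one_pow hα j)
      simp only [Complex.ofReal_mul, Complex.ofReal_choose, Complex.ofReal_neg, Complex.ofReal_pow,
        Complex.ofReal_one] at this
      rw [neg_pow z, ← mul_assoc, this]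
      simp
  rw [e]
  exact h2

lemma hasSum_coeff_mk_pow {q : ℕ → ℝ} {z g : ℂ} (hg : HasSum (fun j => (q j : ℂ) * z ^ j) g)
    (k : ℕ) :
    Summable (fun m => ‖((PowerSeries.coeff m ((PowerSeries.mk q) ^ k) : ℝ) : ℂ) * z ^ m‖) ∧
    ∑' m, ((PowerSeries.coeff m ((PowerSeries.mk q) ^ k) : ℝ) : ℂ) * z ^ m = g ^ k := by
  induction k with
  | zero =>
    have h : ∀ m : ℕ, m ≠ 0 →
        ((PowerSeries.coeff m ((PowerSeries.mk q) ^ 0) : ℝ) : ℂ) * z ^ m = 0 := by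
      intro m hm
      simp [PowerSeries.coeff_one, hm]
    constructor
    · exact (hasSum_single 0 fun m hm => by rw [h m hm, norm_zero]).summable
    · rw [tsum_eq_single 0 h]; simp
  | succ k ih =>
    have key : (fun m => ((PowerSeries.coeff m ((PowerSeries.mk q) ^ (k + 1)) : ℝ) : ℂ) * z ^ m) =
        fun m => ∑ p ∈ Finset.HasAntidiagonal.antidiagonal m,
          (((PowerSeries.coeff p.1 ((PowerSeries.mk q) ^ k) : ℝ) : ℂ) * z ^ p.1) *
            ((q p.2 : ℂ) * z ^ p.2) := by
      funext m
      rw [pow_succ, PowerSeries.coeff_mul, Complex.ofReal_sum, Finset.sum_mul]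
      refine Finset.sum_congr rfl fun p hp => ?_
      rw [← Finset.HasAntidiagonal.mem_antidiagonal.1 hp, pow_add, PowerSeries.coeff_mk, Complex.ofReal_mul]
      ring
    constructor
    · simpa only [← congrFun key _] using
        summable_norm_sum_mul_antidiagonal_of_summable_norm ih.1 hg.summable.norm
    · rw [key, ← tsum_mul_tsum_eq_tsum_sum_antidiagonal_of_summable_norm ih.1 hg.summable.norm,
        ih.2, hg.tsum_eq, pow_succ]

lemma integral_exp_int_mul_I (m n : ℕ) :
    ∫ t in (-Real.pi)..Real.pi, Complex.exp (((m : ℂ) - n) * (t * Complex.I)) =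
      if m = n then 2 * (Real.pi : ℂ) else 0 := by
  split_ifs with h
  · subst h
    simp
    ring
  · have hc : ((m : ℂ) - n) * Complex.I ≠ 0 :=
      mul_ne_zero (sub_ne_zero.2 (by exact_mod_cast h)) Complex.I_ne_zero
    have e : ∀ t : ℝ, ((m : ℂ) - n) * (t * Complex.I) = (((m : ℂ) - n) * Complex.I) * t :=
      fun t => by ring
    simp only [e]
    rw [integral_exp_mul_complex hc]
    have h2 : Complex.exp (((m : ℂ) - n) * Complex.I * (Real.pi : ℝ)) =
        Complex.exp (((m : ℂ) - n) * Complex.I * (-Real.pi : ℝ)) := by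
      rw [Complex.exp_eq_exp_iff_exists_int]
      exact ⟨(m : ℤ) - n, by push_cast; ring⟩
    rw [h2, sub_self, zero_div]

/-- Cauchy's coefficient formula on the circle of radius `r`. -/
lemma coeff_mul_pow_eq_integral {a : ℕ → ℝ} {r : ℝ} {F : ℝ → ℂ}
    (hs : Summable fun m => ‖(a m : ℂ) * (r : ℂ) ^ m‖)
    (hF : ∀ t : ℝ, ∑' m, (a m : ℂ) * ((r : ℂ) * Complex.exp (t * Complex.I)) ^ m = F t) (n : ℕ) :
    ∫ t in (-Real.pi)..Real.pi, F t * Complex.exp (-(n : ℂ) * (t * Complex.I)) =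
      2 * Real.pi * ((a n : ℂ) * (r : ℂ) ^ n) := by
  let f : ℕ → ℝ → ℂ := fun m t =>
    ((a m : ℂ) * (r : ℂ) ^ m) * Complex.exp (((m : ℂ) - n) * (t * Complex.I))
  have hf : ∀ m t, f m t = (a m : ℂ) * ((r : ℂ) * Complex.exp (t * Complex.I)) ^ m *
      Complex.exp (-(n : ℂ) * (t * Complex.I)) := by
    intro m t
    simp only [f]
    rw [mul_pow, ← Complex.exp_nat_mul, sub_eq_add_neg, add_mul, Complex.exp_add]
    ring
  have hn : ∀ m t, ‖f m t‖ = ‖(a m : ℂ) * (r : ℂ) ^ m‖ := by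
    intro m t
    have : ((m : ℂ) - n) * (t * Complex.I) = (((m : ℝ) - n) * t : ℝ) * Complex.I := by
      push_cast; ring
    simp only [f]
    rw [norm_mul, this, Complex.norm_exp_ofReal_mul_I, mul_one]
  have h1 : HasSum (fun m => ∫ t in (-Real.pi)..Real.pi, f m t)
      (∫ t in (-Real.pi)..Real.pi, F t * Complex.exp (-(n : ℂ) * (t * Complex.I))) := by
    refine intervalIntegral.hasSum_integral_of_dominated_convergence
      (fun m _ => ‖(a m : ℂ) * (r : ℂ) ^ m‖) ?_ ?_ ?_ ?_ ?_
    · intro m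
      exact Continuous.aestronglyMeasurable (by fun_prop)
    · exact fun m => Filter.Eventually.of_forall fun t _ => (hn m t).le
    · exact Filter.Eventually.of_forall fun t _ => hs
    · exact intervalIntegrable_const
    · refine Filter.Eventually.of_forall fun t _ => ?_
      have hsum : Summable (fun m => f m t) := Summable.of_norm (by simpa only [hn] using hs)
      have := hsum.hasSum
      simp only [hf, tsum_mul_right, hF] at this
      simpa only [hf] using this
  have h2 : ∀ m, ∫ t in (-Real.pi)..Real.pi, f m t =
      if m = n then 2 * Real.pi * ((a n : ℂ) * (r : ℂ) ^ n) else 0 := by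
    intro m
    simp only [f]
    rw [intervalIntegral.integral_const_mul, integral_exp_int_mul_I]
    split_ifs with h
    · subst h; ring
    · simp
  simp only [h2] at h1
  exact h1.unique (hasSum_ite_eq n _)

lemma coeff_mk_pow_nonneg {q : ℕ → ℝ} (hq : ∀ j, 0 ≤ q j) (n k : ℕ) :
    0 ≤ PowerSeries.coeff n ((PowerSeries.mk q) ^ k) := by
  induction k generalizing n with
  | zero => rw [pow_zero, PowerSeries.coeff_one]; split_ifs <;> norm_num
  | succ k ih =>
    rw [pow_succ, PowerSeries.coeff_mul]
    exact Finset.sum_nonneg fun p _ => mul_nonneg (ih _) (by simpa using hq _)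

/-- The sequence `f` is `1 + O(1/n)`. -/
def RelOne (f : ℕ → ℝ) : Prop :=
  (fun n => f n - 1) =O[Filter.atTop] (fun n : ℕ => (1 : ℝ) / n)

namespace RelOne

lemma tendsto {f : ℕ → ℝ} (hf : RelOne f) : Filter.Tendsto f Filter.atTop (nhds 1) := by
  have h := Asymptotics.IsBigO.trans_tendsto hf tendsto_one_div_atTop_nhds_zero_nat
  simpa using h.add_const 1

lemma mul {f g : ℕ → ℝ} (hf : RelOne f) (hg : RelOne g) : RelOne (fun n => f n * g n) := by
  have h1 : (fun n => f n * (g n - 1)) =O[Filter.atTop] (fun n : ℕ => (1 : ℝ) * (1 / n)) :=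
    (hf.tendsto.isBigO_one ℝ).mul hg
  simp only [one_mul] at h1
  refine (h1.add hf).congr_left fun n => ?_
  ring

lemma comp_differentiableAt {f : ℕ → ℝ} (hf : RelOne f) {φ : ℝ → ℝ} (hφ : DifferentiableAt ℝ φ 1)
    (h1 : φ 1 = 1) : RelOne (fun n => φ (f n)) := by
  have h := hφ.isBigO_sub.comp_tendsto hf.tendsto
  simp only [Function.comp_def, h1] at h
  exact h.trans hf

lemma inv {f : ℕ → ℝ} (hf : RelOne f) : RelOne (fun n => (f n)⁻¹) :=
  hf.comp_differentiableAt (φ := fun t => t⁻¹) (differentiableAt_inv one_ne_zero) inv_one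

lemma rpow {f : ℕ → ℝ} (hf : RelOne f) (p : ℝ) : RelOne (fun n => f n ^ p) :=
  hf.comp_differentiableAt (φ := fun t => t ^ p)
    (Real.differentiableAt_rpow_const_of_ne p one_ne_zero) (Real.one_rpow p)

lemma congr {f g : ℕ → ℝ} (hf : RelOne f) (h : f =ᶠ[Filter.atTop] g) : RelOne g := by
  refine Asymptotics.IsBigO.congr' hf ?_ Filter.EventuallyEq.rfl
  filter_upwards [h] with n hn
  rw [hn]

lemma of_le {f : ℕ → ℝ} (C : ℝ) (h : ∀ᶠ n : ℕ in Filter.atTop, |f n - 1| ≤ C / n) :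
    RelOne f := by
  refine Asymptotics.IsBigO.of_bound C ?_
  filter_upwards [h] with n hn
  rw [Real.norm_eq_abs, Real.norm_eq_abs, abs_of_nonneg (a := (1 : ℝ) / n) (by positivity)]
  calc _ ≤ _ := hn
    _ = _ := by ring

lemma comp_index {f : ℕ → ℝ} (hf : RelOne f) {κ : ℕ → ℕ} {c : ℝ} (hc : 0 < c)
    (hκ : ∀ n : ℕ, c * n ≤ κ n) : RelOne (fun n => f (κ n)) := by
  have ht : Filter.Tendsto κ Filter.atTop Filter.atTop := by
    rw [← tendsto_natCast_atTop_iff (R := ℝ)]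
    exact Filter.tendsto_atTop_mono hκ
      (tendsto_natCast_atTop_atTop.const_mul_atTop hc)
  have h := Asymptotics.IsBigO.comp_tendsto hf ht
  refine h.trans (Asymptotics.IsBigO.of_bound (1 / c) ?_)
  filter_upwards [Filter.eventually_gt_atTop 0] with n hn
  have hn' : (0 : ℝ) < n := by exact_mod_cast hn
  have hk : 0 < (κ n : ℝ) := lt_of_lt_of_le (by positivity) (hκ n)
  simp only [Function.comp_def]
  rw [Real.norm_of_nonneg (by positivity), Real.norm_of_nonneg (by positivity),
    div_mul_div_comm, one_mul]
  exact one_div_le_one_div_of_le (by positivity) (hκ n)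

end RelOne

lemma Gamma_add_le {y s : ℝ} (hy : 0 < y) (hs : s ∈ Set.Ioo (0 : ℝ) 1) :
    Real.Gamma (y + s) ≤ Real.Gamma y * y ^ s := by
  have hG := Real.Gamma_pos_of_pos hy
  have h := Real.Gamma_mul_add_mul_le_rpow_Gamma_mul_rpow_Gamma (s := y) (t := y + 1) (a := 1 - s)
    (b := s) hy (by linarith) (by linarith [hs.2]) hs.1 (by ring)
  have e : (1 - s) * y + s * (y + 1) = y + s := by ring
  rw [e, Real.Gamma_add_one hy.ne', Real.mul_rpow hy.le hG.le] at h
  calc _ ≤ _ := h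
    _ = (Real.Gamma y ^ (1 - s) * Real.Gamma y ^ s) * y ^ s := by ring
    _ = _ := by rw [← Real.rpow_add hG]; simp

lemma relOne_Gamma_ratio_of_lt_one {s : ℝ} (hs : s ∈ Set.Ioo (0 : ℝ) 1) :
    RelOne (fun n : ℕ => Real.Gamma (n + s) / (Real.Gamma n * (n : ℝ) ^ s)) := by
  refine RelOne.of_le 1 ?_
  filter_upwards [Filter.eventually_gt_atTop 0] with n hn
  have hn' : (0 : ℝ) < n := by exact_mod_cast hn
  have hG := Real.Gamma_pos_of_pos hn'
  have hns : (0 : ℝ) < n + s := by linarith [hs.1]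
  have hp : 0 < (n : ℝ) ^ s := Real.rpow_pos_of_pos hn' s
  have hup := Gamma_add_le hn' hs
  have hlo := Gamma_add_le (y := n + s) (s := 1 - s) hns
    ⟨by linarith [hs.2], by linarith [hs.1]⟩
  rw [show (n : ℝ) + s + (1 - s) = n + 1 by ring, Real.Gamma_add_one hn'.ne'] at hlo
  have h1 : Real.Gamma (n + s) / (Real.Gamma n * (n : ℝ) ^ s) ≤ 1 := by
    rw [div_le_one (by positivity)]; exact hup
  have hGs := Real.Gamma_pos_of_pos hns
  have h2 : (n : ℝ) / (n + s) ≤ Real.Gamma (n + s) / (Real.Gamma n * (n : ℝ) ^ s) := by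
    rw [div_le_div_iff₀ hns (by positivity)]
    have h3 : ((n : ℝ)) ^ s ≤ (n + s) ^ s :=
      Real.rpow_le_rpow hn'.le (by linarith [hs.1]) hs.1.le
    calc (n : ℝ) * (Real.Gamma n * (n : ℝ) ^ s) = (n * Real.Gamma n) * (n : ℝ) ^ s := by ring
      _ ≤ (Real.Gamma (n + s) * (n + s) ^ (1 - s)) * (n + s) ^ s := by gcongr
      _ = Real.Gamma (n + s) * ((n + s) ^ (1 - s) * (n + s) ^ s) := by ring
      _ = _ := by rw [← Real.rpow_add hns]; simp
  have h4 : 1 - 1 / (n : ℝ) ≤ n / (n + s) := by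
    rw [le_div_iff₀ hns, sub_mul, div_mul_eq_mul_div, sub_le_iff_le_add, ← sub_le_iff_le_add',
      le_div_iff₀ hn']
    nlinarith [hs.1, hs.2]
  rw [abs_le]
  constructor <;> linarith [show 0 < 1 / (n : ℝ) by positivity]

lemma relOne_Gamma_ratio {a : ℝ} (ha : 0 ≤ a) :
    RelOne (fun n : ℕ => Real.Gamma (n + a) / (Real.Gamma n * (n : ℝ) ^ a)) := by
  obtain ⟨m, s, hs0, hs1, rfl⟩ : ∃ (m : ℕ) (s : ℝ), 0 ≤ s ∧ s < 1 ∧ a = s + m :=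
    ⟨⌊a⌋₊, a - ⌊a⌋₊, by linarith [Nat.floor_le ha], by linarith [Nat.lt_floor_add_one a],
      by ring⟩
  clear ha
  induction m with
  | zero =>
    simp only [Nat.cast_zero, add_zero]
    rcases hs0.eq_or_lt with rfl | hs0
    · refine RelOne.of_le 0 ?_
      filter_upwards [Filter.eventually_gt_atTop 0] with n hn
      have := Real.Gamma_pos_of_pos (show (0 : ℝ) < n by exact_mod_cast hn)
      simp [this.ne']
    · exact relOne_Gamma_ratio_of_lt_one ⟨hs0, hs1⟩
  | succ m ih =>
    have h1 : RelOne (fun n : ℕ => 1 + (s + m) / n) :=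
      RelOne.of_le (s + m) (Filter.Eventually.of_forall fun n => by
        rw [add_sub_cancel_left, abs_of_nonneg (by positivity)])
    refine (ih.mul h1).congr ?_
    filter_upwards [Filter.eventually_gt_atTop 0] with n hn
    have hn' : (0 : ℝ) < n := by exact_mod_cast hn
    have hG := Real.Gamma_pos_of_pos hn'
    have hp : 0 < (n : ℝ) ^ (s + m) := Real.rpow_pos_of_pos hn' _
    rw [Nat.cast_succ, ← add_assoc s, ← add_assoc (n : ℝ) (s + m) 1,
      Real.Gamma_add_one (by positivity), Real.rpow_add_one hn'.ne']
    field_simp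

/-- The real function `1 - (1 - z)^α`. -/
noncomputable def gReal (α z : ℝ) : ℝ := 1 - (1 - z) ^ α

/-- The inverse of the saddle-point map, explicitly solved from the saddle-point equation for `x`. -/
noncomputable def saddleInv (α z : ℝ) : ℝ := ((1 - z) ^ (1 - α) - (1 - z)) / (α * z)

lemma gReal_mem {α : ℝ} (hα : α ∈ Set.Ioo (0 : ℝ) 1)
    {z : ℝ} (hz : z ∈ Set.Ioo (0 : ℝ) 1) : gReal α z ∈ Set.Ioo (0 : ℝ) 1 := by
  have h1 : 0 < 1 - z := by linarith [hz.2]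
  have h2 : (1 - z) ^ α < 1 := Real.rpow_lt_one h1.le (by linarith [hz.1]) hα.1
  have h3 : 0 < (1 - z) ^ α := Real.rpow_pos_of_pos h1 α
  exact ⟨by unfold gReal; linarith, by unfold gReal; linarith⟩

lemma hasDerivAt_gReal {α : ℝ} {z : ℝ} (hz : z ∈ Set.Ioo (0 : ℝ) 1) :
    HasDerivAt (gReal α) (α * (1 - z) ^ (α - 1)) z := by
  have h1 : 0 < 1 - z := by linarith [hz.2]
  have h := ((((hasDerivAt_id z).const_sub 1).rpow_const (p := α) (Or.inl h1.ne')).const_sub 1)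
  refine h.congr_deriv ?_
  simp

lemma saddleInv_eq {α : ℝ} (hα : α ∈ Set.Ioo (0 : ℝ) 1) {z : ℝ} (hz : z ∈ Set.Ioo (0 : ℝ) 1) :
    saddleInv α z = gReal α z / (z * (α * (1 - z) ^ (α - 1))) := by
  have h1 : 0 < 1 - z := by linarith [hz.2]
  have h3 : 0 < (1 - z) ^ α := Real.rpow_pos_of_pos h1 α
  have := hα.1
  have := hz.1
  rw [saddleInv, gReal, Real.rpow_sub h1, Real.rpow_sub h1, Real.rpow_one]
  field_simp

lemma saddleInv_pos {α : ℝ} (hα : α ∈ Set.Ioo (0 : ℝ) 1)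
    {z : ℝ} (hz : z ∈ Set.Ioo (0 : ℝ) 1) : 0 < saddleInv α z := by
  have h1 : 0 < 1 - z := by linarith [hz.2]
  have h3 : 0 < (1 - z) ^ (α - 1) := Real.rpow_pos_of_pos h1 _
  have := hα.1
  have := hz.1
  have := (gReal_mem hα hz).1
  rw [saddleInv_eq hα hz]
  positivity

lemma hasDerivAt_hfun {α : ℝ} (hα : α ∈ Set.Ioo (0 : ℝ) 1)
    (x : ℝ) {z : ℝ} (hz : z ∈ Set.Ioo (0 : ℝ) 1) :
    HasDerivAt (hfun α x) ((1 - x / saddleInv α z) / z) z := by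
  have hg := gReal_mem hα hz
  have h := (Real.hasDerivAt_log hz.1.ne').sub
    (((hasDerivAt_gReal hz).log hg.1.ne').const_mul x)
  have h1 : 0 < 1 - z := by linarith [hz.2]
  have h3 : 0 < (1 - z) ^ (α - 1) := Real.rpow_pos_of_pos h1 _
  have := hz.1
  have := hα.1
  have := hg.1
  refine h.congr_deriv ?_
  rw [saddleInv_eq hα hz]
  field_simp

lemma exists_hasDerivAt_saddleInv {α : ℝ} (hα : α ∈ Set.Ioo (0 : ℝ) 1)
    {z : ℝ} (hz : z ∈ Set.Ioo (0 : ℝ) 1) :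
    ∃ d < 0, HasDerivAt (saddleInv α) d z := by
  have h1 : 0 < 1 - z := by linarith [hz.2]
  have hz0 := hz.1
  have hα0 := hα.1
  have hw : 0 < (1 - z) ^ (1 - α) := Real.rpow_pos_of_pos h1 _
  have hid := (hasDerivAt_id z).const_sub 1
  have h := ((hid.rpow_const (p := 1 - α) (Or.inl h1.ne')).sub hid).div
    ((hasDerivAt_id z).const_mul α) (by simpa using ⟨hα0.ne', hz0.ne'⟩)
  refine ⟨_, ?_, h⟩
  refine div_neg_of_neg_of_pos ?_ (by simp only [id]; positivity)
  simp only [id, Pi.sub_apply]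
  have hb := rpow_one_add_lt_one_add_mul_self (s := 1 / (1 - z) - 1) (p := 1 - α)
    (by have : 0 < 1 / (1 - z) := by positivity
        linarith)
    (by have : 1 < 1 / (1 - z) := by rw [lt_div_iff₀ h1]; linarith
        linarith) (by linarith [hα.2]) (by linarith)
  rw [show 1 + (1 / (1 - z) - 1) = (1 - z)⁻¹ by ring, Real.inv_rpow h1.le,
    inv_lt_iff_one_lt_mul₀ hw] at hb
  rw [show (1 : ℝ) - α - 1 = (1 - α) - 1 by ring, Real.rpow_sub h1 (1 - α) 1, Real.rpow_one]
  have e : (-1 * (1 - α) * ((1 - z) ^ (1 - α) / (1 - z)) - -1) * (α * z) -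
      ((1 - z) ^ (1 - α) - (1 - z)) * (α * 1) =
      α * (1 - (1 + (1 - α) * (1 / (1 - z) - 1)) * (1 - z) ^ (1 - α)) := by
    field_simp
    ring
  rw [e]
  exact mul_neg_of_pos_of_neg hα0 (by linarith)

lemma strictAntiOn_saddleInv {α : ℝ} (hα : α ∈ Set.Ioo (0 : ℝ) 1)
    : StrictAntiOn (saddleInv α) (Set.Ioo 0 1) := by
  refine strictAntiOn_of_deriv_neg (convex_Ioo 0 1) ?_ ?_
  · intro z hz
    obtain ⟨d, -, h⟩ := exists_hasDerivAt_saddleInv hα hz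
    exact h.continuousAt.continuousWithinAt
  · intro z hz
    rw [interior_Ioo] at hz
    obtain ⟨d, hd, h⟩ := exists_hasDerivAt_saddleInv hα hz
    rwa [h.deriv]

lemma saddleInv_of_deriv_eq_zero {α : ℝ} (hα : α ∈ Set.Ioo (0 : ℝ) 1)
    {x z : ℝ} (hz : z ∈ Set.Ioo (0 : ℝ) 1)
    (h : deriv (hfun α x) z = 0) : saddleInv α z = x := by
  rw [(hasDerivAt_hfun hα x hz).deriv, div_eq_zero_iff, or_iff_left hz.1.ne', sub_eq_zero,
    eq_div_iff (saddleInv_pos hα hz).ne', one_mul] at h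
  exact h

lemma hasDerivAt_deriv_hfun {α : ℝ} (hα : α ∈ Set.Ioo (0 : ℝ) 1)
    {x z : ℝ} (hz : z ∈ Set.Ioo (0 : ℝ) 1)
    (h : saddleInv α z = x) :
    ∃ d < 0, HasDerivAt (deriv (hfun α x)) d z := by
  obtain ⟨d, hd, hs⟩ := exists_hasDerivAt_saddleInv hα hz
  have hu := saddleInv_pos hα hz
  have hx : 0 < x := h ▸ hu
  have hz0 := hz.1
  have he : deriv (hfun α x) =ᶠ[nhds z] fun y => (1 - x / saddleInv α y) / y := by
    filter_upwards [isOpen_Ioo.mem_nhds hz] with y hy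
    exact (hasDerivAt_hfun hα x hy).deriv
  have hd1 := (((hs.fun_inv hu.ne').const_mul x).const_sub 1).div (hasDerivAt_id z) hz0.ne'
  refine ⟨d / (x * z), div_neg_of_neg_of_pos hd (by positivity), ?_⟩
  refine HasDerivAt.congr_of_eventuallyEq ?_ he
  simp only [div_eq_mul_inv x]
  convert! hd1 using 1
  simp only [h, id]
  field_simp
  ring

lemma hfun_le_of_saddleInv_eq {α : ℝ} (hα : α ∈ Set.Ioo (0 : ℝ) 1)
    {x z y : ℝ} (hz : z ∈ Set.Ioo (0 : ℝ) 1)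
    (h : saddleInv α z = x) (hy : y ∈ Set.Ioo (0 : ℝ) 1) : hfun α x y ≤ hfun α x z := by
  have hx : 0 < x := h ▸ saddleInv_pos hα hz
  rcases le_total y z with hyz | hyz
  · have hsub : Set.Icc y z ⊆ Set.Ioo 0 1 := fun t ht =>
      ⟨hy.1.trans_le ht.1, ht.2.trans_lt hz.2⟩
    refine monotoneOn_of_deriv_nonneg (convex_Icc y z) ?_ ?_ ?_ (Set.left_mem_Icc.2 hyz)
      (Set.right_mem_Icc.2 hyz) hyz
    · exact fun t ht => (hasDerivAt_hfun hα x (hsub ht)).continuousAt.continuousWithinAt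
    · exact fun t ht => (hasDerivAt_hfun hα x
        (hsub (interior_subset ht))).differentiableAt.differentiableWithinAt
    · intro t ht
      have ht' := interior_subset ht
      rw [(hasDerivAt_hfun hα x (hsub ht')).deriv]
      have hle := (strictAntiOn_saddleInv hα).antitoneOn (hsub ht') hz ht'.2
      rw [h] at hle
      have := (hsub ht').1
      refine div_nonneg (sub_nonneg.2 ?_) this.le
      rwa [div_le_one (saddleInv_pos hα (hsub ht'))]
  · have hsub : Set.Icc z y ⊆ Set.Ioo 0 1 := fun t ht =>
      ⟨hz.1.trans_le ht.1, ht.2.trans_lt hy.2⟩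
    refine antitoneOn_of_deriv_nonpos (convex_Icc z y) ?_ ?_ ?_ (Set.left_mem_Icc.2 hyz)
      (Set.right_mem_Icc.2 hyz) hyz
    · exact fun t ht => (hasDerivAt_hfun hα x (hsub ht)).continuousAt.continuousWithinAt
    · exact fun t ht => (hasDerivAt_hfun hα x
        (hsub (interior_subset ht))).differentiableAt.differentiableWithinAt
    · intro t ht
      have ht' := interior_subset ht
      rw [(hasDerivAt_hfun hα x (hsub ht')).deriv]
      have hle := (strictAntiOn_saddleInv hα).antitoneOn hz (hsub ht') ht'.1
      rw [h] at hle
      have := (hsub ht').1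
      refine div_nonpos_of_nonpos_of_nonneg (sub_nonpos.2 ?_) this.le
      rwa [one_le_div (saddleInv_pos hα (hsub ht'))]

lemma continuousAt_saddle {α : ℝ} (hα : α ∈ Set.Ioo (0 : ℝ) 1) {zf : ℝ → ℝ}
    (hzf : ∀ x ∈ Set.Ioo (0 : ℝ) 1, zf x ∈ Set.Ioo (0 : ℝ) 1 ∧ saddleInv α (zf x) = x)
    {x : ℝ} (hx : x ∈ Set.Ioo (0 : ℝ) 1) : ContinuousAt zf x := by
  have hanti : StrictAntiOn zf (Set.Ioo 0 1) := by
    intro a ha b hb hab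
    by_contra hcon
    have := (strictAntiOn_saddleInv hα).antitoneOn (hzf a ha).1 (hzf b hb).1 (not_lt.1 hcon)
    rw [(hzf a ha).2, (hzf b hb).2] at this
    linarith
  obtain ⟨hz, hxz⟩ := hzf x hx
  refine tendsto_order.2 ⟨fun a ha => ?_, fun b hb => ?_⟩
  · obtain ⟨c, hc1, hc2⟩ := exists_between (max_lt ha hz.1)
    have hc : c ∈ Set.Ioo (0 : ℝ) 1 := ⟨(le_max_right _ _).trans_lt hc1, hc2.trans hz.2⟩
    have hlt := strictAntiOn_saddleInv hα hc hz hc2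
    rw [hxz] at hlt
    filter_upwards [Iio_mem_nhds hlt, isOpen_Ioo.mem_nhds hx] with y hy hy'
    refine (le_max_left _ _).trans_lt (hc1.trans ?_)
    by_contra hcon
    have := (strictAntiOn_saddleInv hα).antitoneOn (hzf y hy').1 hc (not_lt.1 hcon)
    rw [(hzf y hy').2] at this
    exact absurd hy (not_lt.2 this)
  · obtain ⟨c, hc1, hc2⟩ := exists_between (lt_min hb hz.2)
    have hc : c ∈ Set.Ioo (0 : ℝ) 1 := ⟨hz.1.trans hc1, hc2.trans_le (min_le_right _ _)⟩
    have hlt := strictAntiOn_saddleInv hα hz hc hc1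
    rw [hxz] at hlt
    filter_upwards [Ioi_mem_nhds hlt, isOpen_Ioo.mem_nhds hx] with y hy hy'
    refine lt_of_lt_of_le (lt_trans ?_ hc2) (min_le_left _ _)
    by_contra hcon
    have := (strictAntiOn_saddleInv hα).antitoneOn hc (hzf y hy').1 (not_lt.1 hcon)
    rw [(hzf y hy').2] at this
    exact absurd hy (not_lt.2 this)

/-- The envelope theorem for the rate function. -/
lemma hasDerivAt_Ifun {α : ℝ} (hα : α ∈ Set.Ioo (0 : ℝ) 1) {zf : ℝ → ℝ}
    (hzf : ∀ x ∈ Set.Ioo (0 : ℝ) 1, zf x ∈ Set.Ioo (0 : ℝ) 1 ∧ saddleInv α (zf x) = x)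
    {x : ℝ} (hx : x ∈ Set.Ioo (0 : ℝ) 1) :
    HasDerivAt (Ifun α zf) (-Real.log (gReal α (zf x))) x := by
  obtain ⟨hz, hxz⟩ := hzf x hx
  have hdiff : ∀ y w v, hfun α y w = hfun α v w - (y - v) * Real.log (gReal α w) := by
    intro y w v
    simp only [hfun, gReal]
    ring
  have hcont : Filter.Tendsto (fun y => Real.log (gReal α (zf x)) - Real.log (gReal α (zf y)))
      (nhds x) (nhds 0) := by
    have h1 : ContinuousAt (fun y => Real.log (gReal α (zf y))) x :=
      ContinuousAt.log (ContinuousAt.comp (g := gReal α)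
        (hasDerivAt_gReal hz).continuousAt (continuousAt_saddle hα hzf hx))
        (gReal_mem hα hz).1.ne'
    have := (tendsto_const_nhds (x := Real.log (gReal α (zf x)))).sub h1.tendsto
    simpa using this
  rw [hasDerivAt_iff_isLittleO]
  have ho : (fun y => (y - x) * (Real.log (gReal α (zf x)) - Real.log (gReal α (zf y))))
      =o[nhds x] fun y => y - x := by
    have := (Asymptotics.isBigO_refl (fun y : ℝ => y - x) (nhds x)).mul_isLittleO
      ((Asymptotics.isLittleO_one_iff ℝ).2 hcont)
    simpa using this
  refine Asymptotics.IsBigO.trans_isLittleO (Asymptotics.IsBigO.of_bound 1 ?_) ho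
  filter_upwards [isOpen_Ioo.mem_nhds hx] with y hy
  obtain ⟨hzy, hyz⟩ := hzf y hy
  have h1 := hfun_le_of_saddleInv_eq hα hz hxz hzy
  have h2 := hfun_le_of_saddleInv_eq hα hzy hyz hz
  rw [hdiff y (zf x) x] at h2
  have h3 := hdiff y (zf y) x
  simp only [Ifun, smul_eq_mul, one_mul]
  rw [Real.norm_of_nonneg (by linarith)]
  refine le_trans ?_ (le_abs_self _)
  linarith

lemma integrable_pow_mul_exp_neg_mul_sq {b : ℝ} (hb : 0 < b) (p : ℕ) :
    MeasureTheory.Integrable fun t : ℝ => t ^ p * Real.exp (-b * t ^ 2) := by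
  have h := integrable_rpow_mul_exp_neg_mul_sq hb (s := p)
    (lt_of_lt_of_le (by norm_num) (Nat.cast_nonneg p))
  simpa only [Real.rpow_natCast] using h

lemma integral_pow_mul_exp_neg_mul_sq_of_odd (b : ℝ) {p : ℕ} (hp : Odd p) :
    ∫ t : ℝ, t ^ p * Real.exp (-b * t ^ 2) = 0 := by
  have h := MeasureTheory.integral_neg_eq_self
    (fun t : ℝ => t ^ p * Real.exp (-b * t ^ 2)) MeasureTheory.volume
  simp only [hp.neg_pow, neg_sq, neg_mul, MeasureTheory.integral_neg] at h
  simp only [neg_mul]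
  linarith

/-- The error weight in the Laplace expansion. -/
noncomputable def laplaceWeight (s : ℝ) (k : ℕ) (t : ℝ) : ℝ :=
  Real.exp (-(k * s) * t ^ 2) * ((k : ℝ) ^ 2 * t ^ 6 + k * t ^ 4 + t ^ 2)

lemma integrable_laplaceWeight {s : ℝ} (hs : 0 < s) {k : ℕ} (hk : 1 ≤ k) :
    MeasureTheory.Integrable (laplaceWeight s k) := by
  have hk' : (0 : ℝ) < k := by exact_mod_cast hk
  have hb : 0 < k * s := by positivity
  have h := (((integrable_pow_mul_exp_neg_mul_sq hb 6).const_mul ((k : ℝ) ^ 2)).add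
    ((integrable_pow_mul_exp_neg_mul_sq hb 4).const_mul (k : ℝ))).add
    (integrable_pow_mul_exp_neg_mul_sq hb 2)
  refine h.congr (Filter.Eventually.of_forall fun t => ?_)
  simp only [laplaceWeight, Pi.add_apply]
  ring

lemma integral_laplaceWeight (s : ℝ) {k : ℕ} (hk : 1 ≤ k) :
    ∫ t, laplaceWeight s k t = (∫ t, laplaceWeight s 1 t) / (k * √k) := by
  have hk' : (0 : ℝ) < k := by exact_mod_cast hk
  have hsq : √(k : ℝ) ^ 2 = k := Real.sq_sqrt hk'.le
  have e : ∀ t, laplaceWeight s k t = (k : ℝ)⁻¹ * laplaceWeight s 1 (√k * t) := by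
    intro t
    simp only [laplaceWeight, mul_pow, hsq, Nat.cast_one,
      show √(k : ℝ) ^ 6 = (√(k : ℝ) ^ 2) ^ 3 by ring,
      show √(k : ℝ) ^ 4 = (√(k : ℝ) ^ 2) ^ 2 by ring]
    rw [show -(k * s) * t ^ 2 = -(1 * s) * (k * t ^ 2) by ring]
    field_simp
  simp only [e]
  rw [MeasureTheory.integral_const_mul, MeasureTheory.Measure.integral_comp_mul_left,
    abs_of_nonneg (by positivity), smul_eq_mul]
  field_simp

/-- Pointwise form of the Laplace expansion near the saddle point. -/
lemma norm_exp_saddle_sub_le {L M c m A₀ : ℂ} {s K B ε t b : ℝ} {k : ℕ} (hε : |t| ≤ ε)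
    (hK : 0 ≤ K) (hb : |b| ≤ B)
    (hL : ‖L + s * t ^ 2 / 2 - c * t ^ 3‖ ≤ K * t ^ 4)
    (hL' : ‖L + s * t ^ 2 / 2‖ ≤ s * t ^ 2 / 4)
    (hM : ‖M - m * t‖ ≤ K * t ^ 2) :
    ‖Complex.exp L ^ k * Complex.exp (b * t * Complex.I) * (A₀ * Complex.exp M) -
      A₀ * (Real.exp (-(k * (s / 2)) * t ^ 2) : ℝ) * (1 + (k * c * t ^ 3 + (b * Complex.I + m) * t))‖
      ≤ (‖A₀‖ * (K + 2 * ((‖c‖ + K * ε) ^ 2 + (B + ‖m‖ + K * ε) ^ 2) *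
          Real.exp ((B + ‖m‖ + K * ε) * ε))) * laplaceWeight (s / 4) k t := by
  have hε0 : 0 ≤ ε := (abs_nonneg t).trans hε
  have hB : 0 ≤ B := (abs_nonneg b).trans hb
  set w : ℂ := k * (L + s * t ^ 2 / 2) + (b * t * Complex.I + M) with hw
  set w₀ : ℂ := k * c * t ^ 3 + (b * Complex.I + m) * t with hw₀
  set D : ℝ := B + ‖m‖ + K * ε with hD
  have hD0 : 0 ≤ D := by positivity
  have nk : ‖(k : ℂ)‖ = k := by simp
  have e1 : Complex.exp L ^ k * Complex.exp (b * t * Complex.I) * (A₀ * Complex.exp M) =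
      A₀ * (Real.exp (-(k * (s / 2)) * t ^ 2) : ℝ) * Complex.exp w := by
    rw [← Complex.exp_nat_mul, Complex.ofReal_exp]
    calc _ = A₀ * (Complex.exp (k * L) * Complex.exp (b * t * Complex.I) * Complex.exp M) := by ring
      _ = A₀ * Complex.exp (k * L + b * t * Complex.I + M) := by
        rw [Complex.exp_add, Complex.exp_add]
      _ = _ := by
        rw [mul_assoc A₀, ← Complex.exp_add]
        congr 2
        rw [hw]; push_cast; ring
  have ht2 : |t| ^ 2 = t ^ 2 := sq_abs t
  have hMb : ‖b * t * Complex.I + M‖ ≤ D * |t| := by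
    calc ‖b * t * Complex.I + M‖ = ‖b * t * Complex.I + m * t + (M - m * t)‖ := by congr 1; ring
      _ ≤ ‖b * t * Complex.I‖ + ‖m * t‖ + ‖M - m * t‖ := norm_add₃_le
      _ ≤ |b| * |t| + ‖m‖ * |t| + K * t ^ 2 := by
        gcongr
        · simp
        · simp
      _ ≤ B * |t| + ‖m‖ * |t| + K * ε * |t| := by
        have h1 : t ^ 2 ≤ ε * |t| := by
          rw [← ht2, sq]
          exact mul_le_mul_of_nonneg_right hε (abs_nonneg t)
        have h2 := mul_le_mul_of_nonneg_left h1 hK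
        have h3 := mul_le_mul_of_nonneg_right hb (abs_nonneg t)
        linarith
      _ = _ := by ring
  have hw1 : ‖w‖ ≤ k * (s * t ^ 2 / 4) + D * ε := by
    refine (norm_add_le _ _).trans ?_
    rw [norm_mul, nk]
    gcongr
    exact hMb.trans (by gcongr)
  have hw2 : ‖w‖ ≤ k * ((‖c‖ + K * ε) * |t| ^ 3) + D * |t| := by
    refine (norm_add_le _ _).trans ?_
    rw [norm_mul, nk]
    gcongr
    calc ‖L + s * t ^ 2 / 2‖ = ‖(L + s * t ^ 2 / 2 - c * t ^ 3) + c * t ^ 3‖ := by congr 1; ring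
      _ ≤ K * t ^ 4 + ‖c‖ * |t| ^ 3 := by
        refine (norm_add_le _ _).trans ?_
        gcongr
        simp
      _ ≤ K * ε * |t| ^ 3 + ‖c‖ * |t| ^ 3 := by
        have h1 : t ^ 4 ≤ ε * |t| ^ 3 := by
          rw [show t ^ 4 = (t ^ 2) ^ 2 by ring, ← ht2, show (|t| ^ 2) ^ 2 = |t| * |t| ^ 3 by ring]
          exact mul_le_mul_of_nonneg_right hε (by positivity)
        have h2 := mul_le_mul_of_nonneg_left h1 hK
        linarith
      _ = _ := by ring
  have hsq : ‖w‖ ^ 2 ≤ 2 * ((‖c‖ + K * ε) ^ 2 + D ^ 2) * ((k : ℝ) ^ 2 * t ^ 6 + k * t ^ 4 + t ^ 2) := by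
    have h1 : ‖w‖ ^ 2 ≤ (k * ((‖c‖ + K * ε) * |t| ^ 3) + D * |t|) ^ 2 := by gcongr
    have h2 : (k * ((‖c‖ + K * ε) * |t| ^ 3) + D * |t|) ^ 2 ≤
        2 * ((k * ((‖c‖ + K * ε) * |t| ^ 3)) ^ 2 + (D * |t|) ^ 2) := add_sq_le
    have h3 : (k * ((‖c‖ + K * ε) * |t| ^ 3)) ^ 2 = (‖c‖ + K * ε) ^ 2 * ((k : ℝ) ^ 2 * t ^ 6) := by
      rw [show t ^ 6 = (t ^ 2) ^ 3 by ring, ← ht2]; ring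
    have h4 : (D * |t|) ^ 2 = D ^ 2 * t ^ 2 := by rw [mul_pow, ht2]
    rw [h3, h4] at h2
    have p1 : 0 ≤ (k : ℝ) ^ 2 * t ^ 6 := by positivity
    have p2 : 0 ≤ (k : ℝ) * t ^ 4 := by positivity
    have p3 : 0 ≤ t ^ 2 := by positivity
    have q1 : 0 ≤ (‖c‖ + K * ε) ^ 2 := by positivity
    have q2 : 0 ≤ D ^ 2 := by positivity
    nlinarith [mul_nonneg q1 p2, mul_nonneg q1 p3, mul_nonneg q2 p1, mul_nonneg q2 p2]
  have hexp : ‖Complex.exp w - (1 + w)‖ ≤ ‖w‖ ^ 2 * Real.exp ‖w‖ := by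
    have := Complex.norm_exp_sub_sum_le_norm_mul_exp w 2
    simpa [Finset.sum_range_succ] using this
  have hww : ‖w - w₀‖ ≤ K * ((k : ℝ) ^ 2 * t ^ 6 + k * t ^ 4 + t ^ 2) := by
    calc ‖w - w₀‖ = ‖k * (L + s * t ^ 2 / 2 - c * t ^ 3) + (M - m * t)‖ := by
          rw [hw, hw₀]; congr 1; ring
      _ ≤ k * (K * t ^ 4) + K * t ^ 2 := by
        refine (norm_add_le _ _).trans ?_
        rw [norm_mul, nk]
        gcongr
      _ ≤ _ := by
        have : 0 ≤ K * ((k : ℝ) ^ 2 * t ^ 6) := by positivity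
        linarith
  set Q : ℝ := (k : ℝ) ^ 2 * t ^ 6 + k * t ^ 4 + t ^ 2 with hQ
  have hQ0 : 0 ≤ Q := by positivity
  have hs : 0 ≤ k * (s * t ^ 2 / 4) := mul_nonneg (Nat.cast_nonneg k) ((norm_nonneg _).trans hL')
  have hE1 : Real.exp (-(k * (s / 2)) * t ^ 2) ≤ Real.exp (-(k * (s / 4)) * t ^ 2) := by
    apply Real.exp_le_exp.2
    linarith
  have hE2 : Real.exp (-(k * (s / 2)) * t ^ 2) * Real.exp ‖w‖ ≤
      Real.exp (-(k * (s / 4)) * t ^ 2) * Real.exp (D * ε) := by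
    rw [← Real.exp_add, ← Real.exp_add]
    apply Real.exp_le_exp.2
    linarith
  rw [e1, ← mul_sub, norm_mul, norm_mul, Complex.norm_real, Real.norm_of_nonneg (Real.exp_nonneg _)]
  have hfin : ‖Complex.exp w - (1 + w₀)‖ ≤
      K * Q + 2 * ((‖c‖ + K * ε) ^ 2 + D ^ 2) * Q * Real.exp ‖w‖ := by
    calc ‖Complex.exp w - (1 + w₀)‖ = ‖(w - w₀) + (Complex.exp w - (1 + w))‖ := by congr 1; ring
      _ ≤ _ := by
        refine (norm_add_le _ _).trans (add_le_add hww (hexp.trans ?_))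
        gcongr
  calc _ ≤ ‖A₀‖ * Real.exp (-(k * (s / 2)) * t ^ 2) *
        (K * Q + 2 * ((‖c‖ + K * ε) ^ 2 + D ^ 2) * Q * Real.exp ‖w‖) := by gcongr
    _ = ‖A₀‖ * (K * Q * Real.exp (-(k * (s / 2)) * t ^ 2) + 2 * ((‖c‖ + K * ε) ^ 2 + D ^ 2) * Q *
        (Real.exp (-(k * (s / 2)) * t ^ 2) * Real.exp ‖w‖)) := by ring
    _ ≤ ‖A₀‖ * (K * Q * Real.exp (-(k * (s / 4)) * t ^ 2) + 2 * ((‖c‖ + K * ε) ^ 2 + D ^ 2) * Q *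
        (Real.exp (-(k * (s / 4)) * t ^ 2) * Real.exp (D * ε))) := by gcongr
    _ = _ := by rw [laplaceWeight, ← hQ]; ring

lemma laplaceWeight_anti {s s' : ℝ} (h : s' ≤ s) (k : ℕ) (t : ℝ) :
    laplaceWeight s k t ≤ laplaceWeight s' k t := by
  unfold laplaceWeight
  have : (k : ℝ) * s' * t ^ 2 ≤ k * s * t ^ 2 := by gcongr
  gcongr ?_ * _
  apply Real.exp_le_exp.2
  linarith

lemma exp_mul_le_laplaceWeight {s ε t : ℝ} (hε : 0 < ε) (ht : ε ≤ |t|) {k : ℕ} {a b c : ℝ}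
    (ha : 0 ≤ a) (hb : 0 ≤ b) (hc : 0 ≤ c) :
    Real.exp (-(k * s) * t ^ 2) * (a + k * b * |t| ^ 3 + c * |t|) ≤
      (a / ε ^ 2 + b / ε + c / ε) * laplaceWeight s k t := by
  have ht2 : |t| ^ 2 = t ^ 2 := sq_abs t
  have ht4 : |t| ^ 4 = t ^ 4 := by
    rw [show |t| ^ 4 = (|t| ^ 2) ^ 2 by ring, ht2]; ring
  have h1 : a ≤ a / ε ^ 2 * t ^ 2 := by
    have : ε ^ 2 ≤ t ^ 2 := by rw [← ht2]; gcongr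
    rw [div_mul_eq_mul_div, le_div_iff₀ (by positivity)]
    exact mul_le_mul_of_nonneg_left this ha
  have h2 : c * |t| ≤ c / ε * t ^ 2 := by
    rw [div_mul_eq_mul_div, le_div_iff₀ (by positivity), ← ht2, sq, mul_assoc]
    exact mul_le_mul_of_nonneg_left (mul_le_mul_of_nonneg_left ht (abs_nonneg t)) hc
  have h3 : k * b * |t| ^ 3 ≤ b / ε * (k * t ^ 4) := by
    rw [div_mul_eq_mul_div, le_div_iff₀ (by positivity), ← ht4]
    have : k * b * |t| ^ 3 * ε ≤ k * b * |t| ^ 3 * |t| :=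
      mul_le_mul_of_nonneg_left ht (by positivity)
    calc _ ≤ _ := this
      _ = _ := by ring
  have q1 : 0 ≤ a / ε ^ 2 := by positivity
  have q2 : 0 ≤ b / ε := by positivity
  have q3 : 0 ≤ c / ε := by positivity
  have p1 : 0 ≤ (k : ℝ) ^ 2 * t ^ 6 := by positivity
  have p2 : 0 ≤ (k : ℝ) * t ^ 4 := by positivity
  have p3 : 0 ≤ t ^ 2 := by positivity
  rw [laplaceWeight, mul_left_comm]
  refine mul_le_mul_of_nonneg_left ?_ (Real.exp_nonneg _)
  nlinarith [mul_nonneg q1 p1, mul_nonneg q1 p2, mul_nonneg q2 p1, mul_nonneg q2 p3,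
    mul_nonneg q3 p1, mul_nonneg q3 p2]

/-- The second-order approximation in Laplace's method integrates to its Gaussian part. -/
lemma integral_gaussian_mul_odd {A₀ c d : ℂ} {b : ℝ} (hb : 0 < b) :
    MeasureTheory.Integrable (fun t : ℝ => A₀ * (Real.exp (-b * t ^ 2) : ℝ) *
      (1 + (c * (t : ℂ) ^ 3 + d * t))) ∧
    ∫ t : ℝ, A₀ * (Real.exp (-b * t ^ 2) : ℝ) * (1 + (c * (t : ℂ) ^ 3 + d * t)) =
      A₀ * (√(Real.pi / b) : ℝ) := by
  have i0 : MeasureTheory.Integrable fun t : ℝ => ((Real.exp (-b * t ^ 2) : ℝ) : ℂ) :=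
    (integrable_exp_neg_mul_sq hb).ofReal
  have i1 : MeasureTheory.Integrable
      fun t : ℝ => ((t ^ 1 * Real.exp (-b * t ^ 2) : ℝ) : ℂ) :=
    (integrable_pow_mul_exp_neg_mul_sq hb 1).ofReal
  have i3 : MeasureTheory.Integrable
      fun t : ℝ => ((t ^ 3 * Real.exp (-b * t ^ 2) : ℝ) : ℂ) :=
    (integrable_pow_mul_exp_neg_mul_sq hb 3).ofReal
  have e : (fun t : ℝ => A₀ * (Real.exp (-b * t ^ 2) : ℝ) * (1 + (c * (t : ℂ) ^ 3 + d * t))) =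
      fun t : ℝ => A₀ * ((Real.exp (-b * t ^ 2) : ℝ) : ℂ) +
        ((A₀ * c) * ((t ^ 3 * Real.exp (-b * t ^ 2) : ℝ) : ℂ) +
        (A₀ * d) * ((t ^ 1 * Real.exp (-b * t ^ 2) : ℝ) : ℂ)) := by
    funext t
    push_cast
    ring
  have z1 : ∫ t : ℝ, ((t ^ 1 * Real.exp (-b * t ^ 2) : ℝ) : ℂ) = 0 := by
    rw [integral_complex_ofReal, integral_pow_mul_exp_neg_mul_sq_of_odd b (by decide)]; simp
  have z3 : ∫ t : ℝ, ((t ^ 3 * Real.exp (-b * t ^ 2) : ℝ) : ℂ) = 0 := by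
    rw [integral_complex_ofReal, integral_pow_mul_exp_neg_mul_sq_of_odd b (by decide)]; simp
  have i13 : MeasureTheory.Integrable fun t : ℝ =>
      (A₀ * c) * ((t ^ 3 * Real.exp (-b * t ^ 2) : ℝ) : ℂ) +
        (A₀ * d) * ((t ^ 1 * Real.exp (-b * t ^ 2) : ℝ) : ℂ) :=
    (i3.const_mul _).add (i1.const_mul _)
  rw [e]
  refine ⟨(i0.const_mul _).add i13, ?_⟩
  rw [MeasureTheory.integral_add (i0.const_mul _) i13,
    MeasureTheory.integral_add (i3.const_mul _) (i1.const_mul _),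
    MeasureTheory.integral_const_mul, MeasureTheory.integral_const_mul,
    MeasureTheory.integral_const_mul, z1, z3, integral_complex_ofReal, integral_gaussian]
  simp

/-- Laplace's method with an oscillating factor of bounded frequency. -/
lemma exists_laplace_bound {ψ A L M : ℝ → ℂ} {A₀ c m : ℂ} {s s₁ ε K B : ℝ}
    (hψ : Continuous ψ) (hA : Continuous A) (hε : 0 < ε) (hεπ : ε ≤ Real.pi) (hs : 0 < s)
    (hs₁ : 0 < s₁) (hs₁s : s₁ ≤ s / 4) (hK : 0 ≤ K) (hB : 0 ≤ B)
    (hψ₁ : ∀ t, |t| ≤ Real.pi → ‖ψ t‖ ≤ Real.exp (-s₁ * t ^ 2))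
    (hψL : ∀ t, |t| ≤ ε → ψ t = Complex.exp (L t))
    (hAM : ∀ t, |t| ≤ ε → A t = A₀ * Complex.exp (M t))
    (hL : ∀ t : ℝ, |t| ≤ ε → ‖L t + s * t ^ 2 / 2 - c * t ^ 3‖ ≤ K * t ^ 4)
    (hL' : ∀ t : ℝ, |t| ≤ ε → ‖L t + s * t ^ 2 / 2‖ ≤ s * t ^ 2 / 4)
    (hM : ∀ t : ℝ, |t| ≤ ε → ‖M t - m * t‖ ≤ K * t ^ 2) :
    ∃ C : ℝ, ∀ k : ℕ, 1 ≤ k → ∀ b : ℝ, |b| ≤ B →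
      ‖(∫ t in (-Real.pi)..Real.pi, ψ t ^ k * Complex.exp (b * t * Complex.I) * A t) -
        A₀ * (√(2 * Real.pi / (k * s)) : ℝ)‖ ≤ C / (k * √k) := by
  obtain ⟨Ka, hKa⟩ := (isCompact_Icc (a := -Real.pi) (b := Real.pi)).exists_bound_of_continuousOn
    hA.continuousOn
  have hKa0 : 0 ≤ Ka := (norm_nonneg _).trans
    (hKa 0 ⟨by linarith [Real.pi_pos], by linarith [Real.pi_pos]⟩)
  set C₁ : ℝ := ‖A₀‖ * (K + 2 * ((‖c‖ + K * ε) ^ 2 + (B + ‖m‖ + K * ε) ^ 2) *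
          Real.exp ((B + ‖m‖ + K * ε) * ε)) with hC₁
  have hC₁0 : 0 ≤ C₁ := by positivity
  set C₂ : ℝ := (Ka + ‖A₀‖) / ε ^ 2 + ‖A₀‖ * ‖c‖ / ε + ‖A₀‖ * (B + ‖m‖) / ε with hC₂
  have hC₂0 : 0 ≤ C₂ := by positivity
  refine ⟨(C₁ + C₂) * ∫ t, laplaceWeight s₁ 1 t, fun k hk b hb => ?_⟩
  have hk0 : (0 : ℝ) < k := by exact_mod_cast hk
  set F : ℝ → ℂ := fun t => ψ t ^ k * Complex.exp (b * t * Complex.I) * A t with hF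
  have hFc : Continuous F := by fun_prop
  obtain ⟨hNi, hN⟩ := integral_gaussian_mul_odd (A₀ := A₀) (c := k * c) (d := b * Complex.I + m)
    (b := k * (s / 2)) (by positivity)
  set N : ℝ → ℂ := fun t : ℝ => A₀ * (Real.exp (-(k * (s / 2)) * t ^ 2) : ℝ) *
      (1 + (k * c * (t : ℂ) ^ 3 + (b * Complex.I + m) * t)) with hNdef
  have hFi : MeasureTheory.Integrable ((Set.Icc (-Real.pi) Real.pi).indicator F) :=
    (hFc.continuousOn.integrableOn_Icc).integrable_indicator measurableSet_Icc
  have hFint : ∫ t in (-Real.pi)..Real.pi, F t =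
      ∫ t, (Set.Icc (-Real.pi) Real.pi).indicator F t := by
    rw [intervalIntegral.integral_of_le (by linarith [Real.pi_pos]),
      ← MeasureTheory.integral_Icc_eq_integral_Ioc,
      MeasureTheory.integral_indicator measurableSet_Icc]
  have hpt : ∀ t, ‖(Set.Icc (-Real.pi) Real.pi).indicator F t - N t‖ ≤
      (C₁ + C₂) * laplaceWeight s₁ k t := by
    intro t
    have hw0 : 0 ≤ laplaceWeight s₁ k t := by unfold laplaceWeight; positivity
    rcases le_total |t| ε with ht | ht
    · have hmem : t ∈ Set.Icc (-Real.pi) Real.pi := abs_le.1 (ht.trans hεπ)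
      rw [Set.indicator_of_mem hmem]
      have h := norm_exp_saddle_sub_le (k := k) (b := b) (A₀ := A₀) ht hK hb (hL t ht)
        (hL' t ht) (hM t ht)
      rw [← hC₁, ← hψL t ht, ← hAM t ht] at h
      refine h.trans ((mul_le_mul_of_nonneg_left (laplaceWeight_anti hs₁s k t) hC₁0).trans ?_)
      exact mul_le_mul_of_nonneg_right (by linarith) hw0
    · have hF1 : ‖(Set.Icc (-Real.pi) Real.pi).indicator F t‖ ≤
          Real.exp (-(k * s₁) * t ^ 2) * Ka := by
        by_cases hmem : t ∈ Set.Icc (-Real.pi) Real.pi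
        · rw [Set.indicator_of_mem hmem, hF]
          have h1 : ‖ψ t‖ ^ k ≤ Real.exp (-(k * s₁) * t ^ 2) := by
            calc ‖ψ t‖ ^ k ≤ Real.exp (-s₁ * t ^ 2) ^ k := by
                  gcongr; exact hψ₁ t (abs_le.2 hmem)
              _ = _ := by rw [← Real.exp_nat_mul]; congr 1; ring
          have h2 : ‖Complex.exp (b * t * Complex.I)‖ = 1 := by
            rw [← Complex.ofReal_mul]; exact Complex.norm_exp_ofReal_mul_I _
          simp only [norm_mul, norm_pow, h2, mul_one]
          exact mul_le_mul h1 (hKa t hmem) (norm_nonneg _) (Real.exp_nonneg _)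
        · rw [Set.indicator_of_notMem hmem, norm_zero]
          positivity
      have hN1 : ‖N t‖ ≤ Real.exp (-(k * s₁) * t ^ 2) *
          (‖A₀‖ * (1 + k * ‖c‖ * |t| ^ 3 + (B + ‖m‖) * |t|)) := by
        have h1 : Real.exp (-(k * (s / 2)) * t ^ 2) ≤ Real.exp (-(k * s₁) * t ^ 2) := by
          apply Real.exp_le_exp.2
          have : k * s₁ * t ^ 2 ≤ k * (s / 2) * t ^ 2 := by gcongr; linarith
          linarith
        have h2 : ‖1 + (k * c * (t : ℂ) ^ 3 + (b * Complex.I + m) * t)‖ ≤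
            1 + k * ‖c‖ * |t| ^ 3 + (B + ‖m‖) * |t| := by
          rw [← add_assoc]
          refine norm_add₃_le.trans ?_
          have h3 : ‖(b * Complex.I + m : ℂ)‖ ≤ B + ‖m‖ := by
            refine (norm_add_le _ _).trans ?_
            gcongr
            simpa using hb
          rw [norm_mul (b * Complex.I + m)]
          have h4 := mul_le_mul_of_nonneg_right h3 (abs_nonneg t)
          have h5 : ‖(t : ℂ)‖ = |t| := Complex.norm_real t
          have h6 : ‖(k * c * (t : ℂ) ^ 3 : ℂ)‖ = k * ‖c‖ * |t| ^ 3 := by simp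
          rw [h5, h6, norm_one]
          linarith
        rw [hNdef]
        simp only [norm_mul ]
        rw [Complex.norm_real, Real.norm_of_nonneg (Real.exp_nonneg _), mul_comm ‖A₀‖, mul_assoc]
        exact mul_le_mul h1 (mul_le_mul_of_nonneg_left h2 (norm_nonneg _)) (by positivity)
          (Real.exp_nonneg _)
      have h := exp_mul_le_laplaceWeight (s := s₁) hε ht (k := k) (a := Ka + ‖A₀‖)
        (b := ‖A₀‖ * ‖c‖) (c := ‖A₀‖ * (B + ‖m‖)) (by positivity) (by positivity) (by positivity)
      rw [← hC₂] at h
      calc _ ≤ _ := norm_sub_le _ _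
        _ ≤ _ := add_le_add hF1 hN1
        _ = _ := by ring
        _ ≤ _ := h
        _ ≤ _ := mul_le_mul_of_nonneg_right (by linarith) hw0
  have hsq : √(2 * Real.pi / (k * s)) = √(Real.pi / (k * (s / 2))) := by
    congr 1; field_simp
  rw [hFint, hsq, ← hN, ← MeasureTheory.integral_sub hFi hNi]
  calc _ ≤ _ := MeasureTheory.norm_integral_le_of_norm_le
        ((integrable_laplaceWeight hs₁ hk).const_mul _) (Filter.Eventually.of_forall hpt)
    _ = _ := by rw [MeasureTheory.integral_const_mul, integral_laplaceWeight s₁ hk]; ring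

lemma integral_norm_pow_le {ψ : ℝ → ℂ} {s₁ : ℝ} (hψ : Continuous ψ) (hs₁ : 0 < s₁)
    (hψ₁ : ∀ t, |t| ≤ Real.pi → ‖ψ t‖ ≤ Real.exp (-s₁ * t ^ 2)) {k : ℕ} (hk : 1 ≤ k) :
    ∫ t in (-Real.pi)..Real.pi, ‖ψ t‖ ^ k ≤ √(Real.pi / s₁) / √k := by
  have hk0 : (0 : ℝ) < k := by exact_mod_cast hk
  have hi := integrable_exp_neg_mul_sq (b := k * s₁) (by positivity)
  have hπ : -Real.pi ≤ Real.pi := by linarith [Real.pi_pos]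
  calc ∫ t in (-Real.pi)..Real.pi, ‖ψ t‖ ^ k
      ≤ ∫ t in (-Real.pi)..Real.pi, Real.exp (-(k * s₁) * t ^ 2) := by
        refine intervalIntegral.integral_mono_on hπ
          (Continuous.intervalIntegrable (by fun_prop) _ _) hi.intervalIntegrable fun t ht => ?_
        calc ‖ψ t‖ ^ k ≤ Real.exp (-s₁ * t ^ 2) ^ k := by
              gcongr; exact hψ₁ t (abs_le.2 ht)
          _ = _ := by rw [← Real.exp_nat_mul]; congr 1; ring
    _ ≤ ∫ t : ℝ, Real.exp (-(k * s₁) * t ^ 2) := by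
        rw [intervalIntegral.integral_of_le hπ]
        exact MeasureTheory.setIntegral_le_integral hi
          (Filter.Eventually.of_forall fun t => Real.exp_nonneg _)
    _ = _ := by
        rw [integral_gaussian, ← Real.sqrt_div' _ hk0.le, div_div, mul_comm s₁]

lemma AnalyticAt.isBigO_taylor {f : ℂ → ℂ} (hf : AnalyticAt ℂ f 0) (N : ℕ) :
    (fun w => f w - ∑ i ∈ Finset.range N, iteratedDeriv i f 0 / i.factorial * w ^ i)
      =O[nhds 0] fun w => ‖w‖ ^ N := by
  have h := hf.hasFPowerSeriesAt.isBigO_sub_partialSum_pow N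
  simpa [FormalMultilinearSeries.partialSum, FormalMultilinearSeries.ofScalars_apply_eq, mul_comm,
    div_eq_mul_inv] using h

/-- Taylor expansion along the imaginary axis. -/
lemma AnalyticAt.exists_taylor_bound_imag {f : ℂ → ℂ} (hf : AnalyticAt ℂ f 0) (N : ℕ) :
    ∃ K : ℝ, 0 ≤ K ∧ ∀ᶠ t : ℝ in nhds 0,
      ‖f (t * Complex.I) - ∑ i ∈ Finset.range N,
        iteratedDeriv i f 0 / i.factorial * (t * Complex.I) ^ i‖ ≤ K * |t| ^ N := by
  obtain ⟨K, hK, h⟩ := (hf.isBigO_taylor N).exists_nonneg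
  refine ⟨K, hK, ?_⟩
  have hc : Filter.Tendsto (fun t : ℝ => (t : ℂ) * Complex.I) (nhds 0) (nhds 0) :=
    Continuous.tendsto' (by fun_prop) _ _ (by simp)
  filter_upwards [hc.eventually h.bound] with t ht
  simpa using ht

/-- A holomorphic function that is real on the real axis has real derivative there. -/
lemma deriv_ofReal_of_eventuallyEq {f : ℂ → ℂ} {ρ : ℝ → ℝ} {s d : ℝ}
    (hf : DifferentiableAt ℂ f s) (hρ : HasDerivAt ρ d s)
    (h : ∀ᶠ y : ℝ in nhds s, f y = ρ y) : deriv f s = d :=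
  (hf.hasDerivAt.comp_ofReal.congr_of_eventuallyEq
    (h.mono fun _ hy => hy.symm)).unique hρ.ofReal_comp

/-- Laplace's method for an integrand given near the origin by analytic exponents. -/
lemma exists_laplace_bound_of_analyticAt {ψ A : ℝ → ℂ} {ℓ M : ℂ → ℂ} {A₀ : ℂ} {σ : ℝ}
    (hψ : Continuous ψ) (hA : Continuous A) (hσ : 0 < σ)
    (hℓ : AnalyticAt ℂ ℓ 0) (hℓ0 : ℓ 0 = 0) (hℓ1 : deriv ℓ 0 = 0) (hℓ2 : deriv (deriv ℓ) 0 = σ)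
    (hM : AnalyticAt ℂ M 0) (hM0 : M 0 = 0)
    (hψℓ : ∀ᶠ t : ℝ in nhds 0, ψ t = Complex.exp (ℓ (t * Complex.I)))
    (hAM : ∀ᶠ t : ℝ in nhds 0, A t = A₀ * Complex.exp (M (t * Complex.I)))
    (hlt : ∀ t, t ≠ 0 → |t| ≤ Real.pi → ‖ψ t‖ < 1) {B : ℝ} (hB : 0 ≤ B) :
    ∃ s₁ > 0, (∀ t, |t| ≤ Real.pi → ‖ψ t‖ ≤ Real.exp (-s₁ * t ^ 2)) ∧
    ∃ C : ℝ, ∀ k : ℕ, 1 ≤ k → ∀ b : ℝ, |b| ≤ B →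
      ‖(∫ t in (-Real.pi)..Real.pi, ψ t ^ k * Complex.exp (b * t * Complex.I) * A t) -
        A₀ * (√(2 * Real.pi / (k * σ)) : ℝ)‖ ≤ C / (k * √k) := by
  obtain ⟨K₁, hK₁, h1⟩ := hℓ.exists_taylor_bound_imag 4
  obtain ⟨K₂, hK₂, h2⟩ := hM.exists_taylor_bound_imag 2
  set c : ℂ := iteratedDeriv 3 ℓ 0 / 6 * Complex.I ^ 3 with hc
  set m : ℂ := deriv M 0 * Complex.I with hm
  have hℓ2' : iteratedDeriv 2 ℓ 0 = σ := by
    rw [iteratedDeriv_succ, iteratedDeriv_one, hℓ2]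
  have t4 : ∀ t : ℝ, |t| ^ 4 = t ^ 4 := fun t => (even_two_mul 2).pow_abs t
  have e1 : ∀ᶠ t : ℝ in nhds 0,
      ‖ℓ (t * Complex.I) + σ * t ^ 2 / 2 - c * t ^ 3‖ ≤ K₁ * t ^ 4 := by
    filter_upwards [h1] with t ht
    rw [t4] at ht
    convert ht using 2
    simp only [Finset.sum_range_succ, Finset.sum_range_zero, iteratedDeriv_zero, hℓ0,
      iteratedDeriv_one, hℓ1, hℓ2', hc, mul_pow, Complex.I_sq, Nat.factorial]
    push_cast
    ring
  have e2 : ∀ᶠ t : ℝ in nhds 0, ‖M (t * Complex.I) - m * t‖ ≤ K₂ * t ^ 2 := by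
    filter_upwards [h2] with t ht
    rw [sq_abs] at ht
    convert ht using 2
    simp only [Finset.sum_range_succ, Finset.sum_range_zero, iteratedDeriv_zero, hM0,
      iteratedDeriv_one, hm, Nat.factorial]
    push_cast
    ring
  have e3 : ∀ᶠ t : ℝ in nhds 0, K₁ * t ^ 2 + ‖c‖ * |t| < σ / 4 := by
    have hcont : Filter.Tendsto (fun t : ℝ => K₁ * t ^ 2 + ‖c‖ * |t|) (nhds 0) (nhds 0) :=
      Continuous.tendsto' (by fun_prop) _ _ (by simp)
    exact hcont.eventually_lt_const (by positivity)
  obtain ⟨δ, hδ, hall⟩ := Metric.eventually_nhds_iff.1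
    (hψℓ.and (hAM.and (e1.and (e2.and e3))))
  set ε : ℝ := min (δ / 2) Real.pi with hεdef
  have hε : 0 < ε := lt_min (by positivity) Real.pi_pos
  have hεπ : ε ≤ Real.pi := min_le_right _ _
  have hall' : ∀ t : ℝ, |t| ≤ ε → _ := fun t ht => hall (y := t) (by
    rw [Real.dist_eq, sub_zero]
    exact (ht.trans (min_le_left _ _)).trans_lt (by linarith))
  have hL' : ∀ t : ℝ, |t| ≤ ε → ‖ℓ (t * Complex.I) + σ * t ^ 2 / 2‖ ≤ σ * t ^ 2 / 4 := by
    intro t ht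
    obtain ⟨-, -, h1, -, h3⟩ := hall' t ht
    calc ‖ℓ (t * Complex.I) + σ * t ^ 2 / 2‖
        = ‖(ℓ (t * Complex.I) + σ * t ^ 2 / 2 - c * t ^ 3) + c * t ^ 3‖ := by congr 1; ring
      _ ≤ K₁ * t ^ 4 + ‖c‖ * |t| ^ 3 := by
        refine (norm_add_le _ _).trans (add_le_add h1 ?_)
        simp
      _ = (K₁ * t ^ 2 + ‖c‖ * |t|) * |t| ^ 2 := by
        rw [← sq_abs, ← t4]; ring
      _ ≤ σ / 4 * |t| ^ 2 := by gcongr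
      _ = _ := by rw [sq_abs]; ring
  have hcomp : IsCompact {t : ℝ | ε ≤ |t| ∧ |t| ≤ Real.pi} := by
    refine (isCompact_Icc (a := -Real.pi) (b := Real.pi)).of_isClosed_subset ?_
      fun t ht => abs_le.1 ht.2
    exact (isClosed_le continuous_const continuous_abs).inter
      (isClosed_le continuous_abs continuous_const)
  obtain ⟨t₀, ht₀, hmax⟩ := hcomp.exists_isMaxOn
    ⟨Real.pi, by simpa [abs_of_pos Real.pi_pos] using hεπ⟩ (hψ.norm.continuousOn)
  have hρ : ‖ψ t₀‖ < 1 := hlt t₀ (abs_pos.1 (hε.trans_le ht₀.1)) ht₀.2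
  set s₁ : ℝ := min (σ / 4) ((1 - ‖ψ t₀‖) / Real.pi ^ 2) with hs₁def
  have hs₁ : 0 < s₁ := lt_min (by positivity) (div_pos (by linarith) (by positivity))
  have hdecay : ∀ t, |t| ≤ Real.pi → ‖ψ t‖ ≤ Real.exp (-s₁ * t ^ 2) := by
    intro t ht
    rcases le_total |t| ε with h | h
    · rw [(hall' t h).1, Complex.norm_exp]
      apply Real.exp_le_exp.2
      have h1 := (Complex.re_le_norm _).trans (hL' t h)
      have h2 : (ℓ (t * Complex.I) + σ * t ^ 2 / 2).re = (ℓ (t * Complex.I)).re + σ * t ^ 2 / 2 := by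
        rw [Complex.add_re, show (σ * t ^ 2 / 2 : ℂ) = ((σ * t ^ 2 / 2 : ℝ) : ℂ) by push_cast; rfl,
          Complex.ofReal_re]
      have h3 : s₁ * t ^ 2 ≤ σ / 4 * t ^ 2 := by gcongr; exact min_le_left _ _
      linarith
    · have h1 : ‖ψ t‖ ≤ ‖ψ t₀‖ := hmax ⟨h, ht⟩
      have h2 : s₁ * t ^ 2 ≤ (1 - ‖ψ t₀‖) / Real.pi ^ 2 * Real.pi ^ 2 := by
        rw [← sq_abs t]
        gcongr
        · exact min_le_right _ _
      rw [div_mul_cancel₀ _ (by positivity)] at h2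
      have h3 := Real.add_one_le_exp (-s₁ * t ^ 2)
      linarith
  refine ⟨s₁, hs₁, hdecay, ?_⟩
  refine exists_laplace_bound (L := fun t => ℓ (t * Complex.I)) (M := fun t => M (t * Complex.I))
    (c := c) (m := m) (K := max K₁ K₂) hψ hA hε hεπ hσ hs₁ (min_le_left _ _)
    (hK₁.trans (le_max_left _ _)) hB hdecay (fun t ht => (hall' t ht).1)
    (fun t ht => (hall' t ht).2.1) (fun t ht => (hall' t ht).2.2.1.trans ?_) hL'
    (fun t ht => (hall' t ht).2.2.2.1.trans ?_)
  · gcongr; exact le_max_left _ _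
  · gcongr; exact le_max_right _ _

/-- The complex extension of `gReal`. -/
noncomputable def gComplex (α : ℝ) (z : ℂ) : ℂ := 1 - (1 - z) ^ (α : ℂ)

lemma gComplex_ofReal (α : ℝ) {y : ℝ} (hy : y ≤ 1) : gComplex α y = gReal α y := by
  unfold gComplex gReal
  rw [Complex.ofReal_sub, Complex.ofReal_cpow (by linarith)]
  simp

lemma one_sub_mem_slitPlane {z : ℂ} (hz : ‖z‖ < 1) : 1 - z ∈ Complex.slitPlane := by
  left
  have := (Complex.re_le_norm z).trans_lt hz
  simp only [Complex.sub_re, Complex.one_re]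
  linarith

lemma analyticAt_gComplex (α : ℝ) {z : ℂ} (hz : ‖z‖ < 1) : AnalyticAt ℂ (gComplex α) z :=
  analyticAt_const.sub ((analyticAt_const.sub analyticAt_id).cpow analyticAt_const
    (one_sub_mem_slitPlane hz))

lemma one_sub_gComplex_ne_zero (α : ℝ) {z : ℂ} (hz : ‖z‖ < 1) : 1 - gComplex α z ≠ 0 := by
  rw [gComplex, sub_sub_cancel, Complex.cpow_def_of_ne_zero
    (Complex.slitPlane_ne_zero (one_sub_mem_slitPlane hz))]
  exact Complex.exp_ne_zero _

lemma norm_ofReal_mul_exp_mul_I {r : ℝ} (hr : 0 ≤ r) (t : ℝ) :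
    ‖(r : ℂ) * Complex.exp (t * Complex.I)‖ = r := by
  rw [norm_mul, Complex.norm_exp_ofReal_mul_I, mul_one, Complex.norm_real, Real.norm_of_nonneg hr]

lemma sibuya_pos {α : ℝ} (hα : α ∈ Set.Ioo (0 : ℝ) 1) (j : ℕ) : 0 < sibuya α (j + 1) := by
  have h1 : 0 < 1 - α := by linarith [hα.2]
  have h2 : 0 < rfac (1 - α) j :=
    div_pos (Real.Gamma_pos_of_pos (by positivity)) (Real.Gamma_pos_of_pos h1)
  have := hα.1
  rw [sibuya]
  positivity

lemma norm_add_mul_exp_lt {a b t : ℝ} (ha : 0 < a) (hb : 0 < b) (ht : t ≠ 0)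
    (htπ : |t| ≤ Real.pi) : ‖(a : ℂ) + b * Complex.exp (t * Complex.I)‖ < a + b := by
  have hcos : Real.cos t < 1 := by
    refine lt_of_le_of_ne (Real.cos_le_one t) fun h => ht ?_
    have := abs_le.1 htπ
    exact (Real.cos_eq_one_iff_of_lt_of_lt (by linarith [Real.pi_pos])
      (by linarith [Real.pi_pos])).1 h
  have hsq : ‖(a : ℂ) + b * Complex.exp (t * Complex.I)‖ ^ 2 =
      a ^ 2 + b ^ 2 + 2 * a * b * Real.cos t := by
    rw [← Complex.normSq_eq_norm_sq, Complex.normSq_apply]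
    simp only [Complex.add_re, Complex.add_im, Complex.ofReal_re, Complex.ofReal_im,
      Complex.re_ofReal_mul, Complex.im_ofReal_mul, Complex.exp_ofReal_mul_I_re,
      Complex.exp_ofReal_mul_I_im]
    linear_combination b ^ 2 * Real.sin_sq_add_cos_sq t
  refine lt_of_pow_lt_pow_left₀ 2 (by positivity) ?_
  rw [hsq]
  nlinarith [mul_pos ha hb]

lemma norm_gComplex_lt {α : ℝ} (hα : α ∈ Set.Ioo (0 : ℝ) 1) {r : ℝ} (hr : r ∈ Set.Ioo (0 : ℝ) 1)
    {t : ℝ} (ht : t ≠ 0) (htπ : |t| ≤ Real.pi) :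
    ‖gComplex α (r * Complex.exp (t * Complex.I))‖ < gReal α r := by
  have hr0 := hr.1
  set z : ℂ := r * Complex.exp (t * Complex.I) with hz
  have hzn : ‖z‖ = r := norm_ofReal_mul_exp_mul_I hr.1.le t
  have hz1 : ‖z‖ < 1 := by rw [hzn]; exact hr.2
  have h1 := hasSum_sibuya hα hz1
  have h2 := hasSum_sibuya hα (z := (r : ℂ)) (by simpa [abs_of_pos hr0] using hr.2)
  have h3 : HasSum (fun j => sibuya α j * r ^ j) (gReal α r) := by
    have : (1 - (1 - (r : ℂ)) ^ (α : ℂ)) = (gReal α r : ℝ) := gComplex_ofReal α hr.2.le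
    rw [this] at h2
    exact_mod_cast h2
  have hn : ∀ j, ‖(sibuya α j : ℂ) * z ^ j‖ = sibuya α j * r ^ j := by
    intro j
    rw [norm_mul, norm_pow, hzn, Complex.norm_real, Real.norm_of_nonneg (sibuya_nonneg hα j)]
  have hgz : gComplex α z = ∑' j, (sibuya α j : ℂ) * z ^ j := h1.tsum_eq.symm
  rw [hgz, ← h3.tsum_eq, ← h1.summable.sum_add_tsum_nat_add 3, ← h3.summable.sum_add_tsum_nat_add 3]
  refine (norm_add_le _ _).trans_lt (add_lt_add_of_lt_of_le ?_ ?_)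
  · have q0 : sibuya α 0 = 0 := rfl
    have e : ∑ i ∈ Finset.range 3, (sibuya α i : ℂ) * z ^ i =
        z * ((sibuya α 1 : ℂ) + ((sibuya α 2 * r : ℝ) : ℂ) * Complex.exp (t * Complex.I)) := by
      simp only [Finset.sum_range_succ, Finset.sum_range_zero, q0, hz]
      push_cast
      ring
    have h4 := norm_add_mul_exp_lt (sibuya_pos hα 0) (mul_pos (sibuya_pos hα 1) hr0) ht htπ
    rw [e, norm_mul, hzn]
    calc _ < r * (sibuya α 1 + sibuya α 2 * r) := mul_lt_mul_of_pos_left h4 hr0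
      _ = _ := by simp only [Finset.sum_range_succ, Finset.sum_range_zero, q0]; ring
  · refine tsum_of_norm_bounded ((summable_nat_add_iff 3).2 h3.summable).hasSum fun j => ?_
    exact (hn (j + 3)).le

lemma continuous_gComplex_circle (α : ℝ) {r : ℝ} (hr : r ∈ Set.Ioo (0 : ℝ) 1) :
    Continuous fun t : ℝ => gComplex α (r * Complex.exp (t * Complex.I)) := by
  rw [continuous_iff_continuousAt]
  intro t
  have h1 : ContinuousAt (gComplex α) (r * Complex.exp (t * Complex.I)) :=
    (analyticAt_gComplex α (by rw [norm_ofReal_mul_exp_mul_I hr.1.le]; exact hr.2)).continuousAt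
  exact ContinuousAt.comp (f := fun t : ℝ => (r : ℂ) * Complex.exp (t * Complex.I)) h1
    (by fun_prop)

/-- The normalised integrand at the saddle point `r`, with its mean phase removed. -/
noncomputable def saddlePhase (α x r t : ℝ) : ℂ :=
  gComplex α (r * Complex.exp (t * Complex.I)) / gReal α r * Complex.exp (-(t / x) * Complex.I)

lemma continuous_saddlePhase (α x : ℝ) {r : ℝ} (hr : r ∈ Set.Ioo (0 : ℝ) 1) :
    Continuous (saddlePhase α x r) := by
  have := continuous_gComplex_circle α hr
  unfold saddlePhase
  fun_prop

lemma norm_saddlePhase {α : ℝ} (hα : α ∈ Set.Ioo (0 : ℝ) 1) (x : ℝ) {r : ℝ}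
    (hr : r ∈ Set.Ioo (0 : ℝ) 1) (t : ℝ) :
    ‖saddlePhase α x r t‖ = ‖gComplex α (r * Complex.exp (t * Complex.I))‖ / gReal α r := by
  have h : ‖Complex.exp (-(t / x) * Complex.I)‖ = 1 := by
    exact_mod_cast Complex.norm_exp_ofReal_mul_I (-(t / x))
  rw [saddlePhase, norm_mul, h, mul_one, norm_div, Complex.norm_real,
    Real.norm_of_nonneg (gReal_mem hα hr).1.le]

/-- The logarithm of the normalised generating function in exponential coordinates. -/
noncomputable def saddleLog (α x r : ℝ) (w : ℂ) : ℂ :=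
  Complex.log (gComplex α (r * Complex.exp w) / gReal α r) - w / x

lemma analyticAt_gComplex_exp (α : ℝ) {r : ℝ} (hr : r ∈ Set.Ioo (0 : ℝ) 1) :
    AnalyticAt ℂ (fun w : ℂ => gComplex α (r * Complex.exp w)) 0 := by
  have h1 : AnalyticAt ℂ (gComplex α) (r * Complex.exp 0) :=
    analyticAt_gComplex α (by simpa [abs_of_pos hr.1] using hr.2)
  exact AnalyticAt.comp (f := fun w : ℂ => (r : ℂ) * Complex.exp w) h1 (by fun_prop)

lemma analyticAt_saddleLog {α : ℝ} (hα : α ∈ Set.Ioo (0 : ℝ) 1) (x : ℝ) {r : ℝ}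
    (hr : r ∈ Set.Ioo (0 : ℝ) 1) : AnalyticAt ℂ (saddleLog α x r) 0 := by
  have hg : (gReal α r : ℂ) ≠ 0 := by exact_mod_cast (gReal_mem hα hr).1.ne'
  refine AnalyticAt.sub (AnalyticAt.clog
    (AnalyticAt.div (analyticAt_gComplex_exp α hr) analyticAt_const hg) ?_) ?_
  · simp [gComplex_ofReal α hr.2.le, hg]
  · exact analyticAt_id.div_const

lemma saddleLog_ofReal {α : ℝ} (hα : α ∈ Set.Ioo (0 : ℝ) 1) {x : ℝ} (hx : x ≠ 0) {r : ℝ}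
    (hr : r ∈ Set.Ioo (0 : ℝ) 1) {s : ℝ} (hs : r * Real.exp s < 1) :
    saddleLog α x r s = ((hfun α x r - hfun α x (r * Real.exp s)) / x : ℝ) := by
  have hmem : r * Real.exp s ∈ Set.Ioo (0 : ℝ) 1 := ⟨mul_pos hr.1 (Real.exp_pos s), hs⟩
  have h1 := (gReal_mem hα hr).1
  have h2 := (gReal_mem hα hmem).1
  rw [saddleLog, ← Complex.ofReal_exp, ← Complex.ofReal_mul, gComplex_ofReal α hs.le,
    ← Complex.ofReal_div, ← Complex.ofReal_log (by positivity), ← Complex.ofReal_div,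
    ← Complex.ofReal_sub]
  congr 1
  rw [Real.log_div h2.ne' h1.ne']
  simp only [hfun, gReal]
  rw [Real.log_mul hr.1.ne' (Real.exp_pos s).ne', Real.log_exp]
  field_simp
  ring

lemma deriv_saddleLog {α : ℝ} (hα : α ∈ Set.Ioo (0 : ℝ) 1) {x : ℝ} (hx : x ≠ 0) {r : ℝ}
    (hr : r ∈ Set.Ioo (0 : ℝ) 1) :
    ∀ᶠ s : ℝ in nhds 0, deriv (saddleLog α x r) s =
      (-(deriv (hfun α x) (r * Real.exp s) * (r * Real.exp s)) / x : ℝ) := by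
  have hopen : ∀ᶠ s : ℝ in nhds 0, r * Real.exp s < 1 := by
    have hc : Filter.Tendsto (fun s : ℝ => r * Real.exp s) (nhds 0) (nhds r) :=
      Continuous.tendsto' (by fun_prop) _ _ (by simp)
    exact hc.eventually_lt_const hr.2
  have han : ∀ᶠ s : ℝ in nhds 0, AnalyticAt ℂ (saddleLog α x r) s := by
    have hc : Filter.Tendsto (fun s : ℝ => (s : ℂ)) (nhds 0) (nhds 0) :=
      Continuous.tendsto' (by fun_prop) _ _ (by simp)
    exact hc.eventually (analyticAt_saddleLog hα x hr).eventually_analyticAt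
  filter_upwards [hopen.eventually_nhds, han] with s hs ha
  have hmem : r * Real.exp s ∈ Set.Ioo (0 : ℝ) 1 :=
    ⟨mul_pos hr.1 (Real.exp_pos s), hs.self_of_nhds⟩
  refine deriv_ofReal_of_eventuallyEq ha.differentiableAt
    (ρ := fun s => (hfun α x r - hfun α x (r * Real.exp s)) / x) ?_
    (hs.mono fun y hy => saddleLog_ofReal hα hx hr hy)
  have h1 := (hasDerivAt_hfun hα x hmem).differentiableAt.hasDerivAt
  have h2 : HasDerivAt (fun s => r * Real.exp s) (r * Real.exp s) s :=
    (Real.hasDerivAt_exp s).const_mul r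
  have h3 := ((HasDerivAt.comp s h1 h2).const_sub (hfun α x r)).div_const x
  exact h3

lemma deriv_deriv_saddleLog {α : ℝ} (hα : α ∈ Set.Ioo (0 : ℝ) 1) {x : ℝ} (hx : x ≠ 0) {r : ℝ}
    (hr : r ∈ Set.Ioo (0 : ℝ) 1) (h0 : deriv (hfun α x) r = 0) {d : ℝ}
    (hd : HasDerivAt (deriv (hfun α x)) d r) :
    deriv (deriv (saddleLog α x r)) 0 = (-d * r ^ 2 / x : ℝ) := by
  have ha := (analyticAt_saddleLog hα x hr).deriv.differentiableAt
  rw [← Complex.ofReal_zero] at ha ⊢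
  refine deriv_ofReal_of_eventuallyEq ha ?_ (deriv_saddleLog hα hx hr)
  have h2 : HasDerivAt (fun s => r * Real.exp s) r 0 := by
    simpa using (Real.hasDerivAt_exp 0).const_mul r
  have h1 : HasDerivAt (fun s => deriv (hfun α x) (r * Real.exp s)) (d * r) 0 :=
    HasDerivAt.comp (h₂ := deriv (hfun α x)) (h := fun s => r * Real.exp s) 0
      (by simpa using hd) h2
  refine ((h1.mul h2).neg.div_const x).congr_deriv ?_
  simp [h0]
  ring

/-- Laplace's method for the generating function of the Sibuya weights at the saddle point. -/
lemma exists_saddle_bound {α : ℝ} (hα : α ∈ Set.Ioo (0 : ℝ) 1) {x : ℝ} (hx : 0 < x) {r : ℝ}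
    (hr : r ∈ Set.Ioo (0 : ℝ) 1) (h0 : deriv (hfun α x) r = 0) {d : ℝ} (hd0 : d < 0)
    (hd : HasDerivAt (deriv (hfun α x)) d r) {B : ℝ} (hB : 0 ≤ B) :
    ∃ s₁ > 0, (∀ t, |t| ≤ Real.pi → ‖saddlePhase α x r t‖ ≤ Real.exp (-s₁ * t ^ 2)) ∧
    ∃ C : ℝ, ∀ k : ℕ, 1 ≤ k → ∀ b : ℝ, |b| ≤ B →
      ‖(∫ t in (-Real.pi)..Real.pi, saddlePhase α x r t ^ k * Complex.exp (b * t * Complex.I) *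
          (1 - gComplex α (r * Complex.exp (t * Complex.I)))⁻¹) -
        (1 - gReal α r : ℂ)⁻¹ * (√(2 * Real.pi / (k * (-d * r ^ 2 / x))) : ℝ)‖ ≤ C / (k * √k) := by
  have hg := gReal_mem hα hr
  have hg0 : (gReal α r : ℂ) ≠ 0 := by exact_mod_cast hg.1.ne'
  have hg1 : (1 - gReal α r : ℂ) ≠ 0 := by
    have : (1 - gReal α r : ℝ) ≠ 0 := by linarith [hg.2]
    exact_mod_cast this
  have hnorm : ∀ t : ℝ, ‖(r : ℂ) * Complex.exp (t * Complex.I)‖ < 1 := fun t => by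
    rw [norm_ofReal_mul_exp_mul_I hr.1.le]; exact hr.2
  have hne : ∀ t : ℝ, 1 - gComplex α (r * Complex.exp (t * Complex.I)) ≠ 0 :=
    fun t => one_sub_gComplex_ne_zero α (hnorm t)
  have hcont := continuous_gComplex_circle α hr
  have hI : Filter.Tendsto (fun t : ℝ => (t : ℂ) * Complex.I) (nhds 0) (nhds 0) :=
    Continuous.tendsto' (by fun_prop) _ _ (by simp)
  have hGan := analyticAt_gComplex_exp α hr
  have hG0 : gComplex α (r * Complex.exp 0) = gReal α r := by
    simp [gComplex_ofReal α hr.2.le]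
  have hquot : AnalyticAt ℂ (fun w : ℂ => (1 - gReal α r : ℂ) / (1 - gComplex α (r * Complex.exp w))) 0 :=
    analyticAt_const.div (analyticAt_const.sub hGan) (by rw [hG0]; exact hg1)
  have hσ : 0 < -d * r ^ 2 / x := div_pos (mul_pos (by linarith) (pow_pos hr.1 2)) hx
  refine exists_laplace_bound_of_analyticAt (ℓ := saddleLog α x r)
    (M := fun w => Complex.log ((1 - gReal α r) / (1 - gComplex α (r * Complex.exp w))))
    (A := fun t => (1 - gComplex α (r * Complex.exp (t * Complex.I)))⁻¹)
    (continuous_saddlePhase α x hr) ((continuous_const.sub hcont).inv₀ hne) hσ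
    (analyticAt_saddleLog hα x hr) ?_ ?_ (deriv_deriv_saddleLog hα hx.ne' hr h0 hd)
    (hquot.clog (by rw [hG0, div_self hg1]; simp))
    (by simp only [hG0, div_self hg1, Complex.log_one]) ?_ ?_ ?_ hB
  · simp [saddleLog, gComplex_ofReal α hr.2.le, hg0]
  · have := (deriv_saddleLog hα hx.ne' hr).self_of_nhds
    simpa [h0] using this
  · have hev : ∀ᶠ w : ℂ in nhds 0, gComplex α (r * Complex.exp w) ≠ 0 :=
      hGan.continuousAt.eventually_ne (by rw [hG0]; exact hg0)
    filter_upwards [hI.eventually hev] with t ht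
    rw [saddleLog, sub_eq_add_neg, Complex.exp_add, Complex.exp_log (div_ne_zero ht hg0),
      saddlePhase]
    congr 2
    ring
  · refine Filter.Eventually.of_forall fun t => ?_
    rw [Complex.exp_log (div_ne_zero hg1 (hne t)), div_eq_mul_inv, inv_mul_cancel_left₀ hg1]
  · intro t ht htπ
    rw [norm_saddlePhase hα x hr, div_lt_one hg.1]
    exact norm_gComplex_lt hα hr ht htπ

/-- The coefficient of `z ^ n` in the `k`-th power of the Sibuya generating function. -/
noncomputable def sibuyaCoeff (α : ℝ) (n k : ℕ) : ℝ :=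
  PowerSeries.coeff n ((PowerSeries.mk (sibuya α)) ^ k)

lemma sibuyaCoeff_nonneg {α : ℝ} (hα : α ∈ Set.Ioo (0 : ℝ) 1) (n k : ℕ) :
    0 ≤ sibuyaCoeff α n k := coeff_mk_pow_nonneg (sibuya_nonneg hα) n k

lemma integral_gComplex_pow {α : ℝ} (hα : α ∈ Set.Ioo (0 : ℝ) 1) {r : ℝ}
    (hr : r ∈ Set.Ioo (0 : ℝ) 1) (n k : ℕ) :
    ∫ t in (-Real.pi)..Real.pi, gComplex α (r * Complex.exp (t * Complex.I)) ^ k *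
      Complex.exp (-(n : ℂ) * (t * Complex.I)) =
      2 * Real.pi * ((sibuyaCoeff α n k : ℂ) * (r : ℂ) ^ n) := by
  refine coeff_mul_pow_eq_integral (a := fun m => sibuyaCoeff α m k)
    (F := fun t => gComplex α (r * Complex.exp (t * Complex.I)) ^ k) ?_ (fun t => ?_) n
  · exact (hasSum_coeff_mk_pow (hasSum_sibuya hα (z := (r : ℂ))
      (by simpa [abs_of_pos hr.1] using hr.2)) k).1
  · exact (hasSum_coeff_mk_pow (hasSum_sibuya hα (z := r * Complex.exp (t * Complex.I))
      (by rw [norm_ofReal_mul_exp_mul_I hr.1.le]; exact hr.2)) k).2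

lemma gComplex_pow_mul_exp {α : ℝ} (hα : α ∈ Set.Ioo (0 : ℝ) 1) (x : ℝ) {r : ℝ}
    (hr : r ∈ Set.Ioo (0 : ℝ) 1) (n k : ℕ) (t : ℝ) :
    gComplex α (r * Complex.exp (t * Complex.I)) ^ k * Complex.exp (-(n : ℂ) * (t * Complex.I)) =
      gReal α r ^ k * (saddlePhase α x r t ^ k *
        Complex.exp ((k / x - n : ℝ) * t * Complex.I)) := by
  have hg0 : (gReal α r : ℂ) ≠ 0 := by exact_mod_cast (gReal_mem hα hr).1.ne'
  rw [saddlePhase, mul_pow, div_pow, ← Complex.exp_nat_mul, mul_assoc _ (Complex.exp _),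
    ← Complex.exp_add, ← mul_assoc ((gReal α r : ℂ) ^ k), mul_div_cancel₀ _ (pow_ne_zero k hg0)]
  congr 2
  push_cast
  ring

lemma norm_gComplex_le {α : ℝ} (hα : α ∈ Set.Ioo (0 : ℝ) 1) {r : ℝ}
    (hr : r ∈ Set.Ioo (0 : ℝ) 1) {t : ℝ} (htπ : |t| ≤ Real.pi) :
    ‖gComplex α (r * Complex.exp (t * Complex.I))‖ ≤ gReal α r := by
  rcases eq_or_ne t 0 with rfl | ht
  · simp [gComplex_ofReal α hr.2.le, abs_of_pos (gReal_mem hα hr).1]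
  · exact (norm_gComplex_lt hα hr ht htπ).le

lemma sibuyaCoeff_mul_pow_le {α : ℝ} (hα : α ∈ Set.Ioo (0 : ℝ) 1) (x : ℝ) {r : ℝ}
    (hr : r ∈ Set.Ioo (0 : ℝ) 1) {s₁ : ℝ} (hs₁ : 0 < s₁)
    (hψ : ∀ t, |t| ≤ Real.pi → ‖saddlePhase α x r t‖ ≤ Real.exp (-s₁ * t ^ 2)) (n : ℕ) {k : ℕ}
    (hk : 1 ≤ k) :
    2 * Real.pi * (sibuyaCoeff α n k * r ^ n) ≤ gReal α r ^ k * (√(Real.pi / s₁) / √k) := by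
  have hπ := Real.pi_pos
  have hr0 := hr.1
  have h := integral_gComplex_pow hα hr n k
  have h2 : ‖(2 * Real.pi * ((sibuyaCoeff α n k : ℂ) * (r : ℂ) ^ n) : ℂ)‖ =
      2 * Real.pi * (sibuyaCoeff α n k * r ^ n) := by
    rw [show (2 * Real.pi * ((sibuyaCoeff α n k : ℂ) * (r : ℂ) ^ n) : ℂ) =
      ((2 * Real.pi * (sibuyaCoeff α n k * r ^ n) : ℝ) : ℂ) by push_cast; rfl, Complex.norm_real,
      Real.norm_of_nonneg]
    have := sibuyaCoeff_nonneg hα n k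
    positivity
  rw [← h2, ← h]
  simp_rw [gComplex_pow_mul_exp hα x hr n k]
  rw [intervalIntegral.integral_const_mul, norm_mul, norm_pow, Complex.norm_real,
    Real.norm_of_nonneg (gReal_mem hα hr).1.le]
  refine mul_le_mul_of_nonneg_left ?_ (pow_nonneg (gReal_mem hα hr).1.le k)
  refine (intervalIntegral.norm_integral_le_integral_norm (by linarith)).trans ?_
  refine le_trans (le_of_eq ?_) (integral_norm_pow_le (continuous_saddlePhase α x hr) hs₁ hψ hk)
  refine intervalIntegral.integral_congr fun t _ => ?_
  have : ‖Complex.exp ((k / x - n : ℝ) * t * Complex.I)‖ = 1 := by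
    rw [← Complex.ofReal_mul]; exact Complex.norm_exp_ofReal_mul_I _
  simp only [norm_mul, norm_pow, this, mul_one]

lemma norm_integral_gComplex_tail_le {α : ℝ} (hα : α ∈ Set.Ioo (0 : ℝ) 1) {r : ℝ}
    (hr : r ∈ Set.Ioo (0 : ℝ) 1) (n k : ℕ) :
    ‖∫ t in (-Real.pi)..Real.pi, gComplex α (r * Complex.exp (t * Complex.I)) ^ k *
      Complex.exp (-(n : ℂ) * (t * Complex.I)) *
        (1 - gComplex α (r * Complex.exp (t * Complex.I)))⁻¹‖ ≤
      2 * Real.pi * (gReal α r ^ k / (1 - gReal α r)) := by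
  have hg := gReal_mem hα hr
  have hπ := Real.pi_pos
  have h := intervalIntegral.norm_integral_le_of_norm_le_const (a := -Real.pi) (b := Real.pi)
    (f := fun t : ℝ => gComplex α (r * Complex.exp (t * Complex.I)) ^ k *
      Complex.exp (-(n : ℂ) * (t * Complex.I)) *
        (1 - gComplex α (r * Complex.exp (t * Complex.I)))⁻¹)
    (C := gReal α r ^ k / (1 - gReal α r)) fun t ht => ?_
  · refine h.trans (le_of_eq ?_)
    rw [abs_of_pos (by linarith)]
    ring
  · rw [Set.uIoc_of_le (by linarith)] at ht
    have hle := norm_gComplex_le hα hr (abs_le.2 ⟨ht.1.le, ht.2⟩)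
    have h1 : ‖Complex.exp (-(n : ℂ) * (t * Complex.I))‖ = 1 := by
      rw [← mul_assoc]
      exact_mod_cast Complex.norm_exp_ofReal_mul_I (-(n : ℝ) * t)
    have h2 : 1 - gReal α r ≤ ‖1 - gComplex α (r * Complex.exp (t * Complex.I))‖ := by
      have := norm_sub_norm_le (1 : ℂ) (gComplex α (r * Complex.exp (t * Complex.I)))
      rw [norm_one] at this
      linarith
    have h3 : 0 < 1 - gReal α r := by linarith [hg.2]
    rw [norm_mul, norm_mul, h1, mul_one, norm_pow, norm_inv, div_eq_mul_inv]
    gcongr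
    exact pow_nonneg hg.1.le k

/-- Partial sums over the exponent are geometric under the integral sign. -/
lemma sum_sibuyaCoeff_eq {α : ℝ} (hα : α ∈ Set.Ioo (0 : ℝ) 1) {r : ℝ}
    (hr : r ∈ Set.Ioo (0 : ℝ) 1) {n k : ℕ} (hk : k ≤ n + 1) :
    2 * Real.pi * ((∑ j ∈ Finset.Icc k n, sibuyaCoeff α n j * r ^ n : ℝ) : ℂ) =
      (∫ t in (-Real.pi)..Real.pi, gComplex α (r * Complex.exp (t * Complex.I)) ^ k *
        Complex.exp (-(n : ℂ) * (t * Complex.I)) *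
          (1 - gComplex α (r * Complex.exp (t * Complex.I)))⁻¹) -
      ∫ t in (-Real.pi)..Real.pi, gComplex α (r * Complex.exp (t * Complex.I)) ^ (n + 1) *
        Complex.exp (-(n : ℂ) * (t * Complex.I)) *
          (1 - gComplex α (r * Complex.exp (t * Complex.I)))⁻¹ := by
  have hcont := continuous_gComplex_circle α hr
  have hne : ∀ t : ℝ, 1 - gComplex α (r * Complex.exp (t * Complex.I)) ≠ 0 :=
    fun t => one_sub_gComplex_ne_zero α
      (by rw [norm_ofReal_mul_exp_mul_I hr.1.le]; exact hr.2)
  have hinv : Continuous fun t : ℝ => (1 - gComplex α (r * Complex.exp (t * Complex.I)))⁻¹ :=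
    (continuous_const.sub hcont).inv₀ hne
  rw [← intervalIntegral.integral_sub (Continuous.intervalIntegrable (by fun_prop) _ _)
    (Continuous.intervalIntegrable (by fun_prop) _ _)]
  push_cast
  rw [Finset.mul_sum]
  simp_rw [← integral_gComplex_pow hα hr n]
  rw [← intervalIntegral.integral_finsetSum
    fun i _ => Continuous.intervalIntegrable (by fun_prop) _ _]
  refine intervalIntegral.integral_congr fun t _ => ?_
  set G := gComplex α (r * Complex.exp (t * Complex.I))
  have hG : 1 - G ≠ 0 := hne t
  rw [← Finset.sum_mul, ← Finset.Ico_succ_right_eq_Icc, Order.succ_eq_add_one]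
  have hgeom := geom_sum_Ico_mul G hk
  rw [← sub_mul, ← sub_mul, mul_right_comm]
  congr 1
  rw [eq_mul_inv_iff_mul_eq₀ hG]
  linear_combination -hgeom

lemma exists_sum_sibuyaCoeff_bound {α : ℝ} (hα : α ∈ Set.Ioo (0 : ℝ) 1) {x : ℝ} (hx : 0 < x)
    {r : ℝ} (hr : r ∈ Set.Ioo (0 : ℝ) 1) (h0 : deriv (hfun α x) r = 0) {d : ℝ} (hd0 : d < 0)
    (hd : HasDerivAt (deriv (hfun α x)) d r) :
    ∃ C₁ C₂ : ℝ, 0 ≤ C₁ ∧ (∀ n k : ℕ, 1 ≤ k →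
        2 * Real.pi * (sibuyaCoeff α n k * r ^ n) ≤ gReal α r ^ k * (C₁ / √k)) ∧
      ∀ n k : ℕ, 1 ≤ k → k ≤ n + 1 → |k / x - n| ≤ 1 / x →
        |2 * Real.pi * (∑ j ∈ Finset.Icc k n, sibuyaCoeff α n j * r ^ n) -
          gReal α r ^ k * ((1 - gReal α r)⁻¹ * √(2 * Real.pi / (k * (-d * r ^ 2 / x))))| ≤
        gReal α r ^ k * (C₂ / (k * √k)) +
          2 * Real.pi * (gReal α r ^ (n + 1) / (1 - gReal α r)) := by
  obtain ⟨s₁, hs₁, hψ, C, hC⟩ := exists_saddle_bound hα hx hr h0 hd0 hd (B := 1 / x)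
    (by positivity)
  refine ⟨√(Real.pi / s₁), C, Real.sqrt_nonneg _, fun n k hk => sibuyaCoeff_mul_pow_le hα x hr hs₁ hψ n hk,
    fun n k hk hkn hb => ?_⟩
  have hg := gReal_mem hα hr
  have h1 := hC k hk _ hb
  have h2 := sum_sibuyaCoeff_eq hα hr hkn
  have h3 := norm_integral_gComplex_tail_le hα hr n (n + 1)
  simp_rw [gComplex_pow_mul_exp hα x hr n k, mul_assoc ((gReal α r : ℂ) ^ k)] at h2
  rw [intervalIntegral.integral_const_mul] at h2
  set J := ∫ t in (-Real.pi)..Real.pi, saddlePhase α x r t ^ k *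
    Complex.exp ((k / x - n : ℝ) * t * Complex.I) *
      (1 - gComplex α (r * Complex.exp (t * Complex.I)))⁻¹
  set T := ∫ t in (-Real.pi)..Real.pi, gComplex α (r * Complex.exp (t * Complex.I)) ^ (n + 1) *
        Complex.exp (-(n : ℂ) * (t * Complex.I)) *
          (1 - gComplex α (r * Complex.exp (t * Complex.I)))⁻¹
  set R := √(2 * Real.pi / (k * (-d * r ^ 2 / x)))
  set S := ∑ j ∈ Finset.Icc k n, sibuyaCoeff α n j * r ^ n
  rw [← Real.norm_eq_abs, ← Complex.norm_real]
  have e : ((2 * Real.pi * S - gReal α r ^ k * ((1 - gReal α r)⁻¹ * R) : ℝ) : ℂ) =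
      (gReal α r : ℂ) ^ k * (J - (1 - gReal α r : ℂ)⁻¹ * (R : ℝ)) - T := by
    push_cast
    rw [h2]
    ring
  rw [e]
  refine (norm_sub_le _ _).trans (add_le_add ?_ h3)
  rw [norm_mul, norm_pow, Complex.norm_real, Real.norm_of_nonneg hg.1.le]
  exact mul_le_mul_of_nonneg_left h1 (pow_nonneg hg.1.le k)

/-- The Gamma quotient `Γ(β + k) / k!`. -/
noncomputable def gammaWeight (β : ℝ) (k : ℕ) : ℝ := Real.Gamma (β + k) / k.factorial

lemma gammaWeight_pos {β : ℝ} (hβ : 0 < β) (k : ℕ) : 0 < gammaWeight β k :=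
  div_pos (Real.Gamma_pos_of_pos (by positivity)) (by positivity)

lemma gammaWeight_add {β : ℝ} (hβ : 0 < β) (k j : ℕ) :
    gammaWeight β (k + j) =
      gammaWeight β k * ∏ i ∈ Finset.range j, (1 + (β - 1) / (k + i + 1)) := by
  induction j with
  | zero => simp
  | succ j ih =>
    rw [Finset.prod_range_succ, ← mul_assoc, ← ih, gammaWeight, gammaWeight, ← add_assoc,
      Nat.factorial_succ]
    push_cast
    have h1 : β + (k + j + 1 : ℝ) = (β + (k + j)) + 1 := by ring
    have h2 : (0 : ℝ) < β + (k + j) := by positivity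
    rw [h1, Real.Gamma_add_one h2.ne']
    have : ((k + j).factorial : ℝ) ≠ 0 := by positivity
    have h3 : (k + j + 1 : ℝ) ≠ 0 := by positivity
    field_simp
    ring

lemma abs_gammaWeight_add_sub_le {β : ℝ} (hβ : 0 < β) {k : ℕ} (hk : 1 ≤ k) (j : ℕ) :
    |gammaWeight β (k + j) - gammaWeight β k| ≤
      gammaWeight β k * (j * (|β - 1| / k) * Real.exp (|β - 1| / k) ^ j) := by
  have hk0 : (0 : ℝ) < k := by exact_mod_cast hk
  have hc := gammaWeight_pos hβ k
  have h1 := Finset.norm_prod_one_add_sub_one_le (Finset.range j)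
    (fun i : ℕ => (β - 1) / ((k : ℝ) + i + 1))
  have h2 : ∑ i ∈ Finset.range j, ‖(β - 1) / ((k : ℝ) + i + 1)‖ ≤ j * (|β - 1| / k) := by
    refine (Finset.sum_le_card_nsmul _ _ (|β - 1| / k) fun i _ => ?_).trans (by simp)
    rw [norm_div, Real.norm_eq_abs, Real.norm_of_nonneg (by positivity)]
    gcongr
    have : (0 : ℝ) ≤ i := Nat.cast_nonneg i
    linarith
  set y : ℝ := j * (|β - 1| / k) with hy
  have h3 : Real.exp y - 1 ≤ y * Real.exp y := by
    have h4 := Real.add_one_le_exp (-y)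
    have h5 : Real.exp (-y) * Real.exp y = 1 := by rw [← Real.exp_add]; simp
    nlinarith [Real.exp_pos y]
  rw [gammaWeight_add hβ, ← mul_sub_one, abs_mul, abs_of_pos hc, ← Real.norm_eq_abs,
    ← Real.exp_nat_mul]
  refine mul_le_mul_of_nonneg_left (h1.trans ((sub_le_sub_right ?_ 1).trans h3)) hc.le
  exact Real.exp_le_exp.2 h2

/-- Slowly varying weights may be frozen at the first index of a geometrically decaying sum. -/
lemma abs_sum_gammaWeight_sub_le {β g q C : ℝ} (hβ : 0 < β) (hg : 0 < g) (hq : q < 1) (hC : 0 ≤ C)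
    {a : ℕ → ℝ} (ha : ∀ k, 0 ≤ a k) (hbound : ∀ k, 1 ≤ k → a k ≤ g ^ k * (C / √k)) {k n : ℕ}
    (hk : 1 ≤ k) (hkq : Real.exp (|β - 1| / k) * g ≤ q) :
    |(∑ j ∈ Finset.Icc k n, gammaWeight β j * a j) - gammaWeight β k * ∑ j ∈ Finset.Icc k n, a j| ≤
      gammaWeight β k * (g ^ k * (C / √k)) * (|β - 1| / k) * ∑' j : ℕ, (j : ℝ) * q ^ j := by
  have hk0 : (0 : ℝ) < k := by exact_mod_cast hk
  have hc := gammaWeight_pos hβ k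
  have hq0 : 0 ≤ q := le_trans (by positivity) hkq
  have hsum : Summable fun j : ℕ => (j : ℝ) * q ^ j := by
    have := summable_pow_mul_geometric_of_norm_lt_one (R := ℝ) 1
      (r := q) (by rwa [Real.norm_of_nonneg hq0])
    simpa using this
  rw [Finset.mul_sum, ← Finset.sum_sub_distrib, ← Finset.Ico_succ_right_eq_Icc,
    Finset.sum_Ico_eq_sum_range]
  refine (Finset.abs_sum_le_sum_abs _ _).trans ?_
  calc _ ≤ ∑ j ∈ Finset.range (Order.succ n - k),
        gammaWeight β k * (g ^ k * (C / √k)) * (|β - 1| / k) * ((j : ℝ) * q ^ j) := by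
        refine Finset.sum_le_sum fun j _ => ?_
        rw [← sub_mul, abs_mul, abs_of_nonneg (ha _)]
        have h1 := abs_gammaWeight_add_sub_le hβ hk j
        have h2 : a (k + j) ≤ g ^ (k + j) * (C / √k) := by
          refine (hbound _ (by omega)).trans ?_
          gcongr
          omega
        have h3 : (Real.exp (|β - 1| / k) * g) ^ j ≤ q ^ j := by gcongr
        calc _ ≤ gammaWeight β k * (j * (|β - 1| / k) * Real.exp (|β - 1| / k) ^ j) *
              (g ^ (k + j) * (C / √k)) := mul_le_mul h1 h2 (ha _) (by positivity)
          _ = gammaWeight β k * (g ^ k * (C / √k)) * (|β - 1| / k) *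
              ((j : ℝ) * (Real.exp (|β - 1| / k) * g) ^ j) := by rw [pow_add, mul_pow]; ring
          _ ≤ _ := by gcongr
    _ ≤ _ := by
        rw [← Finset.mul_sum]
        refine mul_le_mul_of_nonneg_left ?_ (by positivity)
        exact hsum.sum_le_tsum _ fun j _ => by positivity

lemma relOne_sum_gammaWeight_mul_sibuyaCoeff {α : ℝ} (hα : α ∈ Set.Ioo (0 : ℝ) 1) {x : ℝ}
    (hx : x ∈ Set.Ioo (0 : ℝ) 1) {β : ℝ} (hβ : 0 < β)
    {r : ℝ} (hr : r ∈ Set.Ioo (0 : ℝ) 1) (h0 : deriv (hfun α x) r = 0) {d : ℝ} (hd0 : d < 0)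
    (hd : HasDerivAt (deriv (hfun α x)) d r) :
    RelOne fun n : ℕ => 2 * Real.pi * (∑ j ∈ Finset.Icc ⌈x * (n : ℝ)⌉₊ n,
        gammaWeight β j * (sibuyaCoeff α n j * r ^ n)) /
      (gammaWeight β ⌈x * (n : ℝ)⌉₊ * (gReal α r ^ ⌈x * (n : ℝ)⌉₊ * ((1 - gReal α r)⁻¹ *
        √(2 * Real.pi / (⌈x * (n : ℝ)⌉₊ * (-d * r ^ 2 / x)))))) := by
  obtain ⟨hx0, hx1⟩ := hx
  obtain ⟨C₁, C₂, hC₁, hb1, hb2⟩ := exists_sum_sibuyaCoeff_bound hα hx0 hr h0 hd0 hd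
  obtain ⟨hg0, hg1⟩ := gReal_mem hα hr
  have hr0 := hr.1
  have hπ := Real.pi_pos
  set g := gReal α r with hg
  set σ : ℝ := -d * r ^ 2 / x with hσdef
  have hσ : 0 < σ := div_pos (mul_pos (by linarith) (pow_pos hr.1 2)) hx0
  have h1g : 0 < 1 - g := by linarith
  set D : ℝ := (1 - g)⁻¹ * √(2 * Real.pi / σ) with hD
  have hD0 : 0 < D := by positivity
  obtain ⟨q, hgq, hq1⟩ := exists_between hg1
  set Q : ℝ := ∑' j : ℕ, (j : ℝ) * q ^ j with hQ
  have hceil : ∀ n : ℕ, x * n ≤ ⌈x * (n : ℝ)⌉₊ := fun n => Nat.le_ceil _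
  have hev1 : ∀ᶠ n : ℕ in Filter.atTop, Real.exp (|β - 1| / ⌈x * (n : ℝ)⌉₊) * g ≤ q := by
    have h1 : Filter.Tendsto (fun n : ℕ => ((⌈x * (n : ℝ)⌉₊ : ℕ) : ℝ)) Filter.atTop Filter.atTop :=
      Filter.tendsto_atTop_mono hceil (tendsto_natCast_atTop_atTop.const_mul_atTop hx0)
    have h2 : Filter.Tendsto (fun n : ℕ => Real.exp (|β - 1| / ⌈x * (n : ℝ)⌉₊) * g)
        Filter.atTop (nhds g) := by
      have h3 := ((Real.continuous_exp.tendsto 0).comp (h1.const_div_atTop |β - 1|)).mul_const g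
      simpa using h3
    exact (h2.eventually_lt_const hgq).mono fun n hn => hn.le
  have hev2 : ∀ᶠ n : ℕ in Filter.atTop, (n : ℝ) ^ 2 * (g ^ (1 - x)) ^ n ≤ 1 := by
    have h1 : |g ^ (1 - x)| < 1 := by
      rw [abs_of_pos (by positivity)]
      exact Real.rpow_lt_one hg0.le hg1 (by linarith)
    exact ((tendsto_pow_const_mul_const_pow_of_abs_lt_one 2 h1).eventually_lt_const
      zero_lt_one).mono fun n hn => hn.le
  refine RelOne.of_le ((C₁ * |β - 1| * Q + |C₂|) / D / x + 2 * Real.pi / (1 - g) / D) ?_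
  filter_upwards [hev1, hev2, Filter.eventually_ge_atTop 1] with n hn1 hn2 hn
  have hn0 : (0 : ℝ) < n := by exact_mod_cast hn
  set k := ⌈x * (n : ℝ)⌉₊ with hk
  have hkx : x * n ≤ k := hceil n
  have hkx' : (k : ℝ) < x * n + 1 := Nat.ceil_lt_add_one (by positivity)
  have hk0 : (0 : ℝ) < k := lt_of_lt_of_le (by positivity) hkx
  have hk1 : 1 ≤ k := by exact_mod_cast hk0
  have hkn : k ≤ n := by
    apply Nat.ceil_le.2
    nlinarith
  have hb : |k / x - n| ≤ 1 / x := by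
    rw [abs_of_nonneg (by rw [sub_nonneg, le_div_iff₀ hx0]; linarith), sub_le_iff_le_add,
      div_le_iff₀ hx0, add_mul, div_mul_cancel₀ _ hx0.ne']
    linarith
  have hc := gammaWeight_pos hβ k
  have H2 := hb2 n k hk1 (by omega) hb
  have H1 := abs_sum_gammaWeight_sub_le hβ hg0 hq1 hC₁ (n := n)
    (a := fun j => 2 * Real.pi * (sibuyaCoeff α n j * r ^ n))
    (fun j => mul_nonneg (by positivity) (mul_nonneg (sibuyaCoeff_nonneg hα n j) (by positivity)))
    (fun j hj => hb1 n j hj) hk1 hn1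
  rw [← hQ] at H1
  have hsqrt : √(2 * Real.pi / (k * σ)) = √(2 * Real.pi / σ) / √k := by
    rw [← Real.sqrt_div' _ hk0.le, div_div, mul_comm σ]
  rw [hsqrt] at H2 ⊢
  have hsk : 0 < √(k : ℝ) := Real.sqrt_pos.2 hk0
  have eD : (1 - g)⁻¹ * (√(2 * Real.pi / σ) / √k) = D / √k := by rw [hD]; ring
  rw [eD] at H2 ⊢
  have hgk : 0 < g ^ k := by positivity
  set W : ℝ := ∑ j ∈ Finset.Icc k n, gammaWeight β j * (sibuyaCoeff α n j * r ^ n) with hW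
  set S : ℝ := ∑ j ∈ Finset.Icc k n, sibuyaCoeff α n j * r ^ n with hS
  have eW : ∑ j ∈ Finset.Icc k n, gammaWeight β j * (2 * Real.pi * (sibuyaCoeff α n j * r ^ n)) =
      2 * Real.pi * W := by
    rw [hW, Finset.mul_sum]; exact Finset.sum_congr rfl fun j _ => by ring
  rw [eW, ← Finset.mul_sum, ← hS] at H1
  have hden : 0 < gammaWeight β k * (g ^ k * (D / √k)) := by positivity
  have hpow : g ^ (n + 1) = g ^ k * g ^ (n + 1 - k) := by
    rw [← pow_add]; congr 1; omega
  have htail : √(k : ℝ) * g ^ (n + 1 - k) ≤ 1 / n := by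
    have h1 : √(k : ℝ) ≤ n := by
      rw [Real.sqrt_le_left hn0.le]
      have : (k : ℝ) ≤ n := by exact_mod_cast hkn
      have : (1 : ℝ) ≤ n := by exact_mod_cast hn
      nlinarith
    have h2 : g ^ (n + 1 - k) ≤ (g ^ (1 - x)) ^ n := by
      rw [← Real.rpow_natCast, ← Real.rpow_natCast, ← Real.rpow_mul hg0.le]
      refine Real.rpow_le_rpow_of_exponent_ge hg0 hg1.le ?_
      rw [Nat.cast_sub (by omega)]
      push_cast
      linarith
    rw [le_div_iff₀ hn0]
    calc √(k : ℝ) * g ^ (n + 1 - k) * n ≤ n * (g ^ (1 - x)) ^ n * n := by gcongr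
      _ = (n : ℝ) ^ 2 * (g ^ (1 - x)) ^ n := by ring
      _ ≤ 1 := hn2
  have hC₂ : C₂ ≤ |C₂| := le_abs_self _
  have hmain : |2 * Real.pi * W - gammaWeight β k * (g ^ k * (D / √k))| ≤
      gammaWeight β k * (g ^ k * (C₁ / √k)) * (|β - 1| / k) * Q + gammaWeight β k *
        (g ^ k * (C₂ / (k * √k)) + 2 * Real.pi * (g ^ (n + 1) / (1 - g))) := by
    have e : 2 * Real.pi * W - gammaWeight β k * (g ^ k * (D / √k)) =
        (2 * Real.pi * W - gammaWeight β k * (2 * Real.pi * S)) +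
        gammaWeight β k * (2 * Real.pi * S - g ^ k * (D / √k)) := by ring
    rw [e]
    refine (abs_add_le _ _).trans (add_le_add H1 ?_)
    rw [abs_mul, abs_of_pos hc]
    exact mul_le_mul_of_nonneg_left H2 hc.le
  rw [div_sub_one hden.ne', abs_div, abs_of_pos hden]
  have hsplit : (gammaWeight β k * (g ^ k * (C₁ / √k)) * (|β - 1| / k) * Q + gammaWeight β k *
        (g ^ k * (C₂ / (k * √k)) + 2 * Real.pi * (g ^ (n + 1) / (1 - g)))) /
        (gammaWeight β k * (g ^ k * (D / √k))) =
      (C₁ * |β - 1| * Q + C₂) / D / k + 2 * Real.pi / (1 - g) / D * (√k * g ^ (n + 1 - k)) := by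
    rw [hpow]
    field_simp
    ring
  have hQ0 : 0 ≤ Q := tsum_nonneg fun j => mul_nonneg (Nat.cast_nonneg j)
    (pow_nonneg (hg0.le.trans hgq.le) j)
  calc _ ≤ _ := div_le_div_of_nonneg_right hmain hden.le
    _ = _ := hsplit
    _ ≤ (C₁ * |β - 1| * Q + |C₂|) / D / (x * n) + 2 * Real.pi / (1 - g) / D * (1 / n) := by
        gcongr
    _ = _ := by field_simp

lemma RelOne.exists_bound {f : ℕ → ℝ} (hf : RelOne f) :
    ∃ C > 0, ∀ n : ℕ, 1 ≤ n → |f n - 1| ≤ C / n := by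
  obtain ⟨C, hC, h⟩ := Asymptotics.bound_of_isBigO_nat_atTop hf
  refine ⟨C, hC, fun n hn => ?_⟩
  have hn0 : (0 : ℝ) < n := by exact_mod_cast hn
  have := h (x := n) (by positivity)
  rwa [Real.norm_eq_abs, Real.norm_of_nonneg (by positivity), mul_one_div] at this

lemma relOne_factorial_div_Gamma {θ : ℝ} (hθ : 0 < θ) :
    RelOne fun n : ℕ => n.factorial / (Real.Gamma (θ + n) * (n : ℝ) ^ (1 - θ)) := by
  refine (relOne_Gamma_ratio hθ.le).inv.congr ?_
  filter_upwards [Filter.eventually_ge_atTop 1] with n hn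
  have hn0 : (0 : ℝ) < n := by exact_mod_cast hn
  have h1 : (n.factorial : ℝ) = n * Real.Gamma n := by
    rw [← Real.Gamma_add_one hn0.ne', Real.Gamma_nat_eq_factorial]
  have h2 := Real.Gamma_pos_of_pos hn0
  have h3 : 0 < Real.Gamma (θ + n) := Real.Gamma_pos_of_pos (by positivity)
  rw [h1, Real.rpow_sub hn0, Real.rpow_one, add_comm (n : ℝ) θ]
  field_simp

lemma relOne_gammaWeight_ceil {β x : ℝ} (hβ : 0 < β) (hx : 0 < x) :
    RelOne fun n : ℕ => gammaWeight β ⌈x * (n : ℝ)⌉₊ / (⌈x * (n : ℝ)⌉₊ : ℝ) ^ (β - 1) := by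
  refine ((relOne_Gamma_ratio hβ.le).comp_index (κ := fun n : ℕ => ⌈x * (n : ℝ)⌉₊) hx
    fun n => Nat.le_ceil _).congr ?_
  filter_upwards [Filter.eventually_ge_atTop 1] with n hn
  have hn0 : (0 : ℝ) < n := by exact_mod_cast hn
  have hk0 : (0 : ℝ) < ⌈x * (n : ℝ)⌉₊ := lt_of_lt_of_le (by positivity) (Nat.le_ceil _)
  set k := ⌈x * (n : ℝ)⌉₊
  have h1 : (k.factorial : ℝ) = k * Real.Gamma k := by
    rw [← Real.Gamma_add_one hk0.ne', Real.Gamma_nat_eq_factorial]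
  have h2 := Real.Gamma_pos_of_pos hk0
  rw [gammaWeight, h1, Real.rpow_sub hk0, Real.rpow_one, add_comm (k : ℝ) β]
  field_simp

lemma relOne_ceil_div {x : ℝ} (hx : 0 < x) :
    RelOne fun n : ℕ => (⌈x * (n : ℝ)⌉₊ : ℝ) / (x * n) := by
  refine RelOne.of_le (1 / x) ?_
  filter_upwards [Filter.eventually_ge_atTop 1] with n hn
  have hn0 : (0 : ℝ) < n := by exact_mod_cast hn
  have hxn : 0 < x * n := by positivity
  have h1 := Nat.le_ceil (x * (n : ℝ))
  have h2 := Nat.ceil_lt_add_one hxn.le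
  rw [div_sub_one hxn.ne', abs_of_nonneg (div_nonneg (by linarith) hxn.le), div_div]
  gcongr
  linarith

/-- The Gaussian prefactor expressed through the second derivative at the saddle point. -/
lemma sqrt_saddle_eq {x r d k : ℝ} (hx : 0 < x) (hr : 0 < r) (hd : d < 0) (hk : 0 < k) :
    √(2 * Real.pi / (k * (-d * r ^ 2 / x))) =
      2 * Real.pi * (x ^ (1 / 2 : ℝ) / (k ^ (1 / 2 : ℝ) * (r * √(2 * Real.pi * |d|)))) := by
  have hπ := Real.pi_pos
  have hd' : 0 < -d := by linarith
  have h1 : 2 * Real.pi / (k * (-d * r ^ 2 / x)) =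
      (2 * Real.pi) ^ 2 * x / (k * (r ^ 2 * (2 * Real.pi * |d|))) := by
    rw [abs_of_neg hd]
    field_simp
  rw [h1, Real.sqrt_div' _ (by positivity), Real.sqrt_mul (by positivity),
    Real.sqrt_sq (by positivity), Real.sqrt_mul hk.le, Real.sqrt_mul (by positivity),
    Real.sqrt_sq hr.le, Real.sqrt_eq_rpow x, Real.sqrt_eq_rpow k]
  ring

lemma exp_rate_eq {α x r : ℝ} (hα : α ∈ Set.Ioo (0 : ℝ) 1) (hr : r ∈ Set.Ioo (0 : ℝ) 1) (n k : ℕ) :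
    Real.exp (-((k : ℝ) - x * n) * -Real.log (gReal α r)) * Real.exp (-(n : ℝ) * hfun α x r) =
      gReal α r ^ k / r ^ n := by
  have hg := (gReal_mem hα hr).1
  rw [← Real.exp_add]
  have h : -((k : ℝ) - x * n) * -Real.log (gReal α r) + -(n : ℝ) * hfun α x r =
      k * Real.log (gReal α r) - n * Real.log r := by
    simp only [hfun, gReal]
    ring
  rw [h, Real.exp_sub, ← Real.log_pow, ← Real.log_pow, Real.exp_log (pow_pos hg k),
    Real.exp_log (pow_pos hr.1 n)]

/-- precise large deviations for `K_n`: for every fixed `x ∈ (0,1)` there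
is `C > 0` such that for all `n ≥ 1`, writing `{nx} = ⌈nx⌉ - nx`,
`P(K_n ≥ xn) = ∑_{k=⌈xn⌉}^n p_{n,k}` equals
`(Γ(θ)/Γ(θ/α)) n^{(1/α-1)θ-1/2}/(z(x)√(2π|h_x''(z(x))|)) x^{θ/α-1}
(e^{-{nx} I'(x)}/(1-e^{-I'(x)})) e^{-n I(x)}` up to a relative error of at most
`C/(xn)`. -/
theorem precise_large_deviations (α θ : ℝ) (hα : α ∈ Set.Ioo (0 : ℝ) 1)
    (hθ : 0 < θ) (zf : ℝ → ℝ)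
    (hzf : ∀ x ∈ Set.Ioo (0 : ℝ) 1, zf x ∈ Set.Ioo (0 : ℝ) 1 ∧
      deriv (hfun α x) (zf x) = 0)
    (x : ℝ) (hx : x ∈ Set.Ioo (0 : ℝ) 1) :
    ∃ C > (0 : ℝ), ∀ n : ℕ, 1 ≤ n →
      |(∑ k ∈ Finset.Icc ⌈x * (n : ℝ)⌉₊ n, ewensP α θ n k) /
          ((Real.Gamma θ / Real.Gamma (θ / α)) *
            ((n : ℝ) ^ ((1 / α - 1) * θ - 1 / 2) /
              (zf x * Real.sqrt (2 * Real.pi *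
                |deriv (deriv (hfun α x)) (zf x)|))) *
            x ^ (θ / α - 1) *
            (Real.exp (-((⌈x * (n : ℝ)⌉₊ : ℝ) - x * n) * deriv (Ifun α zf) x) /
              (1 - Real.exp (-deriv (Ifun α zf) x))) *
            Real.exp (-(n : ℝ) * Ifun α zf x)) - 1| ≤ C / (x * n) := by
  have hα0 := hα.1
  have hzs : ∀ y ∈ Set.Ioo (0 : ℝ) 1, zf y ∈ Set.Ioo (0 : ℝ) 1 ∧ saddleInv α (zf y) = y :=
    fun y hy => ⟨(hzf y hy).1, saddleInv_of_deriv_eq_zero hα (hzf y hy).1 (hzf y hy).2⟩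
  obtain ⟨hr, h0⟩ := hzf x hx
  obtain ⟨d, hd0, hd⟩ := hasDerivAt_deriv_hfun hα hr (hzs x hx).2
  have hI := (hasDerivAt_Ifun hα hzs hx).deriv
  have hIx : Ifun α zf x = hfun α x (zf x) := rfl
  obtain ⟨hx0, hx1⟩ := hx
  have hβ : 0 < θ / α := by positivity
  set r := zf x with hrdef
  set β := θ / α with hβdef
  obtain ⟨hg0, hg1⟩ := gReal_mem hα hr
  have hr0 := hr.1
  have hfull := (((relOne_factorial_div_Gamma hθ).mul
    (relOne_sum_gammaWeight_mul_sibuyaCoeff hα ⟨hx0, hx1⟩ hβ hr h0 hd0 hd)).mul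
    (relOne_gammaWeight_ceil hβ hx0)).mul ((relOne_ceil_div hx0).rpow (β - 3 / 2))
  obtain ⟨C, hC, hbound⟩ := hfull.exists_bound
  refine ⟨C * x, by positivity, fun n hn => ?_⟩
  have hn0 : (0 : ℝ) < n := by exact_mod_cast hn
  have hk0 : (0 : ℝ) < ⌈x * (n : ℝ)⌉₊ := lt_of_lt_of_le (by positivity) (Nat.le_ceil _)
  have hCx : C * x / (x * n) = C / n := by field_simp
  rw [hCx]
  convert hbound n hn using 3
  rw [hI, hIx, hd.deriv, sqrt_saddle_eq hx0 hr0 hd0 hk0]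
  set k := ⌈x * (n : ℝ)⌉₊
  have hexp := exp_rate_eq (x := x) hα hr n k
  rw [neg_neg, Real.exp_log hg0]
  have hsum : ∑ j ∈ Finset.Icc k n, ewensP α θ n j =
      (n.factorial : ℝ) * (Real.Gamma θ / Real.Gamma (θ + n)) / Real.Gamma β / r ^ n *
        ∑ j ∈ Finset.Icc k n, gammaWeight β j * (sibuyaCoeff α n j * r ^ n) := by
    rw [Finset.mul_sum]
    refine Finset.sum_congr rfl fun j _ => ?_
    rw [ewensP_eq hα hθ, ← hβdef, gammaWeight, sibuyaCoeff]
    field_simp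
  rw [hsum]
  set W := ∑ j ∈ Finset.Icc k n, gammaWeight β j * (sibuyaCoeff α n j * r ^ n)
  set R := √(2 * Real.pi * |d|) with hR
  have hRpos : 0 < R := Real.sqrt_pos.2 (mul_pos (by positivity) (abs_pos.2 hd0.ne))
  have hΓθ : 0 < Real.Gamma θ := Real.Gamma_pos_of_pos hθ
  have hΓβ : 0 < Real.Gamma β := Real.Gamma_pos_of_pos hβ
  have hΓn : 0 < Real.Gamma (θ + n) := Real.Gamma_pos_of_pos (by positivity)
  have h1g : 0 < 1 - gReal α r := by linarith
  have hc := gammaWeight_pos hβ k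
  have hden : Real.Gamma θ / Real.Gamma β * ((n : ℝ) ^ ((1 / α - 1) * θ - 1 / 2) / (r * R)) *
      x ^ (β - 1) * (Real.exp (-((k : ℝ) - x * n) * -Real.log (gReal α r)) / (1 - gReal α r)) *
      Real.exp (-(n : ℝ) * hfun α x r) =
      Real.Gamma θ / Real.Gamma β * ((n : ℝ) ^ ((1 / α - 1) * θ - 1 / 2) / (r * R)) *
      x ^ (β - 1) / (1 - gReal α r) * (gReal α r ^ k / r ^ n) := by
    rw [← hexp]; ring
  have hnpow : (n : ℝ) ^ ((1 / α - 1) * θ - 1 / 2) = (n : ℝ) ^ (1 - θ) * (n : ℝ) ^ (β - 3 / 2) := by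
    rw [← Real.rpow_add hn0]
    congr 1
    rw [hβdef]
    field_simp
    ring
  have hxpow : x ^ (β - 1) = x ^ (β - 3 / 2) * x ^ (1 / 2 : ℝ) := by
    rw [← Real.rpow_add hx0]
    congr 1
    ring
  have hkpow : (k : ℝ) ^ (β - 1) = (k : ℝ) ^ (β - 3 / 2) * (k : ℝ) ^ (1 / 2 : ℝ) := by
    rw [← Real.rpow_add hk0]
    congr 1
    ring
  rw [hden, hnpow, hxpow, hkpow, Real.div_rpow hk0.le (by positivity),
    Real.mul_rpow hx0.le hn0.le]
  have p1 := Real.rpow_pos_of_pos hn0 (1 - θ)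
  have p2 := Real.rpow_pos_of_pos hn0 (β - 3 / 2)
  have p3 := Real.rpow_pos_of_pos hx0 (β - 3 / 2)
  have p4 := Real.rpow_pos_of_pos hx0 (1 / 2 : ℝ)
  have p5 := Real.rpow_pos_of_pos hk0 (β - 3 / 2)
  have p6 := Real.rpow_pos_of_pos hk0 (1 / 2 : ℝ)
  have hπ := Real.pi_pos
  generalize (n : ℝ) ^ (1 - θ) = y₁ at *
  generalize (n : ℝ) ^ (β - 3 / 2) = y₂ at *
  generalize x ^ (β - 3 / 2) = y₃ at *
  generalize x ^ (1 / 2 : ℝ) = y₄ at *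
  generalize (k : ℝ) ^ (β - 3 / 2) = y₅ at *
  generalize (k : ℝ) ^ (1 / 2 : ℝ) = y₆ at *
  field_simp
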